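/- Let F be a free group, and for w ∈ F let |w| denote the length of the reduced word representing w. Let g ≥ 1 and m ≥ 1, let C_1, …, C_{m-1}, C be nontrivial cyclically reduced elements of F, and set s = |C_1| + … + |C_{m-1}| + |C|. Suppose the standard non-orientable quadratic equation ( ∏_{i=1}^{g} x_i² ) · ( ∏_{j=1}^{m-1} z_j⁻¹ C_j z_j ) · C = 1 has a solution in F. Then there exists a solution x_1',…,x_g', z_1',…,z_{m-1}' of the same equation in F all of whose values have length at most 12s⁴, i.e., |x_i'| ≤ 12s⁴ for all i and |z_j'| ≤ 12s⁴ for all j. -/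

import Mathlib

/-- An element of a free group is cyclically reduced if, in its reduced word,
the first letter is not the inverse of the last letter. -/
def CyclicallyReduced {α : Type*} [DecidableEq α] (w : FreeGroup α) : Prop :=
  ∀ x ∈ w.toWord.head?, ∀ y ∈ w.toWord.getLast?, x.1 = y.1 → x.2 = y.2

namespace QE
open FreeGroup

/-- The inverse of a signed letter. -/
def nx {β : Type*} (x : β × Bool) : β × Bool := (x.1, !x.2)

/-- Number of occurrences of a letter (with either sign). -/
def cnt {β : Type*} [DecidableEq β] (b : β) (w : List (β × Bool)) : ℕ := (w.map Prod.fst).count b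

section words
variable {β : Type*}

@[simp] theorem nx_nx (x : β × Bool) : nx (nx x) = x := by simp [nx]
@[simp] theorem nx_fst (x : β × Bool) : (nx x).1 = x.1 := rfl
theorem nx_ne (x : β × Bool) : nx x ≠ x := by
  intro h; have := congrArg Prod.snd h; simp [nx] at this

theorem mk_app (a b : List (β × Bool)) : mk (a ++ b) = mk a * mk b := by rw [mul_mk]
theorem mk_cons (x : β × Bool) (b : List (β × Bool)) : mk (x :: b) = mk [x] * mk b := by
  rw [mul_mk]; rfl
theorem mk_nx (x : β × Bool) : mk [nx x] = (mk [x])⁻¹ := by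
  rw [inv_mk]; rfl
theorem mk_nil : (mk ([] : List (β × Bool))) = 1 := rfl
theorem mk_invRev (w : List (β × Bool)) : mk (invRev w) = (mk w)⁻¹ := by rw [inv_mk]

theorem eq_of_fst {x y : β × Bool} (h : y.1 = x.1) : y = x ∨ y = nx x := by
  rcases x with ⟨a, s⟩; rcases y with ⟨b, t⟩
  cases s <;> cases t <;> simp_all [nx]

/-- Two letter assignments which agree on the letters of a word agree on the word. -/
theorem lift_congr {G : Type*} [Group G] {f f' : β → G} {w : List (β × Bool)}
    (h : ∀ x ∈ w, f x.1 = f' x.1) : lift f (mk w) = lift f' (mk w) := by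
  rw [lift_mk, lift_mk]
  congr 1
  apply List.map_congr_left
  intro x hx
  rw [h x hx]

theorem lift_letter {G : Type*} [Group G] [DecidableEq β] (f : β → G) (x : β × Bool) (a : G) :
    lift (Function.update f x.1 (cond x.2 a a⁻¹)) (mk [x]) = a := by
  rw [lift_mk]; rcases x with ⟨b, s⟩; cases s <;> simp

theorem exists_dup {A : Type*} {l : List A} (h : ¬ l.Nodup) :
    ∃ p x q r, l = p ++ x :: (q ++ x :: r) := by
  induction l with
  | nil => simp at h
  | cons a l ih =>
    by_cases ha : a ∈ l
    · obtain ⟨q, r, rfl⟩ := List.append_of_mem ha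
      exact ⟨[], a, q, r, rfl⟩
    · have : ¬ l.Nodup := fun h' => h (List.nodup_cons.2 ⟨ha, h'⟩)
      obtain ⟨p, x, q, r, rfl⟩ := ih this
      exact ⟨a :: p, x, q, r, rfl⟩

/-- The pattern lemma for words in which each letter occurs once with each sign. -/
theorem pattern {w : List (β × Bool)} (hn : w.Nodup) (hc : ∀ x ∈ w, nx x ∈ w) :
    ∀ n p x q r, q.length ≤ n → w = p ++ x :: (q ++ nx x :: r) →
    (∃ p x r, w = p ++ x :: nx x :: r) ∨
    (∃ p x q y r s t, w = p ++ x :: (q ++ y :: (r ++ nx x :: (s ++ nx y :: t)))) := by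
  intro n
  induction n with
  | zero =>
    intro p x q r hq hw
    have : q = [] := List.eq_nil_of_length_eq_zero (by omega)
    subst this
    exact Or.inl ⟨p, x, r, hw⟩
  | succ n ih =>
    intro p x q r hq hw
    rcases q with _ | ⟨y, q⟩
    · exact Or.inl ⟨p, x, r, hw⟩
    have hy : nx y ∈ w := hc y (by rw [hw]; simp)
    have hn' := hn
    rw [hw] at hy hn'
    have h1 : nx y ≠ x := by
      rintro rfl
      simp only [nx_nx] at hn'
      have : ¬ (y :: q ++ y :: r).Nodup := by simp
      exact this ((List.nodup_cons.1 (List.nodup_append.1 hn').2.1).2)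
    have h2 : nx y ≠ nx x := by
      intro h
      have : y = x := by rw [← nx_nx y, h, nx_nx]
      subst this
      have := (List.nodup_cons.1 (List.nodup_append.1 hn').2.1).1
      simp at this
    simp only [List.mem_append, List.mem_cons, List.cons_append, h1, h2, nx_ne, false_or] at hy
    rcases hy with hy | hy | hy
    · obtain ⟨p1, p2, rfl⟩ := List.append_of_mem hy
      refine Or.inr ⟨p1, nx y, p2, x, [], q, r, ?_⟩
      rw [hw]; simp
    · obtain ⟨q1, q2, rfl⟩ := List.append_of_mem hy
      refine ih (p ++ [x]) y q1 (q2 ++ nx x :: r) ?_ ?_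
      · simp at hq; omega
      · rw [hw]; simp
    · obtain ⟨r1, r2, rfl⟩ := List.append_of_mem hy
      refine Or.inr ⟨p, x, [], y, q, r1, r2, ?_⟩
      rw [hw]; simp

/-- Handle normal form of a word in which each letter occurs once with each sign. -/
theorem nfH [DecidableEq β] : ∀ n (w : List (β × Bool)), w.length ≤ n → w.Nodup →
    (∀ x ∈ w, nx x ∈ w) →
    ∃ H : List (List (β × Bool) × List (β × Bool)),
      mk w = (H.map fun p => mk p.1 * mk p.2 * (mk p.1)⁻¹ * (mk p.2)⁻¹).prod ∧
      (∀ p ∈ H, p.1.length ≤ 2 * w.length ∧ p.2.length ≤ 2 * w.length) ∧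
      (∀ p ∈ H, (∀ x ∈ p.1, x.1 ∈ w.map Prod.fst) ∧ (∀ x ∈ p.2, x.1 ∈ w.map Prod.fst)) ∧
      4 * H.length ≤ w.length ∧
      (∀ (G : Type) [Group G] (H' : List (G × G)), H'.length = H.length →
        ∃ f : β → G, H.map (fun p => (lift f (mk p.1), lift f (mk p.2))) = H') := by
  intro n
  induction n with
  | zero =>
    intro w hw _ _
    have : w = [] := List.eq_nil_of_length_eq_zero (by omega)
    subst this
    exact ⟨[], by simp [mk_nil], by simp, by simp, by simp,
      fun G _ H' h => ⟨fun _ => 1, by simpa using (List.eq_nil_of_length_eq_zero h).symm⟩⟩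
  | succ n ih =>
    intro w hw hn hc
    rcases w with _ | ⟨x0, w0⟩
    · exact ih [] (by simp) hn hc
    have hx0 : nx x0 ∈ w0 := by
      have := hc x0 (by simp)
      simpa [nx_ne] using this
    obtain ⟨q0, r0, rfl⟩ := List.append_of_mem hx0
    rcases pattern hn hc _ [] x0 q0 r0 le_rfl rfl with ⟨p, x, r, hw'⟩ | ⟨p, x, q, y, r, s, t, hw'⟩
    · generalize hW : x0 :: (q0 ++ nx x0 :: r0) = w at *
      subst hw'
      have hperm : (p ++ x :: nx x :: r).Perm (x :: nx x :: (p ++ r)) := by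
        refine List.perm_middle.trans (List.Perm.cons _ List.perm_middle)
      have hn2 := hperm.nodup_iff.1 hn
      have hn3 : (p ++ r).Nodup := (List.nodup_cons.1 (List.nodup_cons.1 hn2).2).2
      obtain ⟨H, e1, e2, e3, e4, e5⟩ := ih (p ++ r) (by simp at hw ⊢; omega) hn3 (by
        intro z hz
        have h1 := hperm.mem_iff.1 (hc z (hperm.mem_iff.2 (by simp [List.mem_append.1 hz])))
        simp only [List.mem_cons] at h1
        rcases h1 with h1 | h1 | h1
        · have : z = nx x := by rw [← h1, nx_nx]
          subst this
          exact absurd hz (List.nodup_cons.1 (List.nodup_cons.1 hn2).2).1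
        · have : z = x := by rw [← nx_nx z, h1, nx_nx]
          subst this
          exact absurd (List.mem_cons_of_mem _ hz) (List.nodup_cons.1 hn2).1
        · exact h1)
      refine ⟨H, ?_, ?_, ?_, ?_, e5⟩
      · rw [← e1, mk_app, mk_cons, mk_cons (nx x), mk_nx, mk_app]; group
      · intro z hz
        have := e2 z hz
        simp at this ⊢; omega
      · intro z hz
        have := e3 z hz
        refine ⟨fun a ha => ?_, fun a ha => ?_⟩
        · have := this.1 a ha
          simp only [List.map_append, List.mem_append, List.map_cons, List.mem_cons] at this ⊢
          tauto
        · have := this.2 a ha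
          simp only [List.map_append, List.mem_append, List.map_cons, List.mem_cons] at this ⊢
          tauto
      · simp at e4 ⊢; omega
    · generalize hW : x0 :: (q0 ++ nx x0 :: r0) = w at *
      set w' := p ++ (s ++ (r ++ (q ++ t))) with hw'def
      have hperm : w.Perm (x :: nx x :: y :: nx y :: w') := by
        rw [hw', List.perm_iff_count]
        intro a
        simp only [hw'def, List.count_append, List.count_cons]
        omega
      have hn2 := hperm.nodup_iff.1 hn
      simp only [List.nodup_cons, List.mem_cons, not_or] at hn2
      obtain ⟨⟨n1, n2, n3, n4⟩, ⟨n5, n6, n7⟩, ⟨n8, n9⟩, n10, n11⟩ := hn2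
      have hlen : w.length = w'.length + 4 := by rw [hperm.length_eq]; rfl
      have hxy : y.1 ≠ x.1 := by
        intro h
        rcases eq_of_fst h with h | h
        · exact n2 h.symm
        · exact n5 h.symm
      have hxw : ∀ z ∈ w', z.1 ≠ x.1 := by
        intro z hz h
        rcases eq_of_fst h with h | h
        · exact n4 (h ▸ hz)
        · exact n7 (h ▸ hz)
      have hyw : ∀ z ∈ w', z.1 ≠ y.1 := by
        intro z hz h
        rcases eq_of_fst h with h | h
        · exact n9 (h ▸ hz)
        · exact n10 (h ▸ hz)
      obtain ⟨H, e1, e2, e3, e4, e5⟩ := ih w' (by omega) n11 (by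
        intro z hz
        have h1 := hperm.mem_iff.1 (hc z (hperm.mem_iff.2 (by simp [hz])))
        simp only [List.mem_cons] at h1
        rcases h1 with h1 | h1 | h1 | h1 | h1
        · exact absurd (congrArg Prod.fst h1) (hxw z hz)
        · exact absurd (congrArg Prod.fst h1) (hxw z hz)
        · exact absurd (congrArg Prod.fst h1) (hyw z hz)
        · exact absurd (congrArg Prod.fst h1) (hyw z hz)
        · exact h1)
      have hsub : ∀ a, a ∈ w'.map Prod.fst → a ∈ w.map Prod.fst := by
        intro a ha
        rw [(hperm.map Prod.fst).mem_iff]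
        simp only [List.map_cons, List.mem_cons]; tauto
      have hmem : ∀ z ∈ w', z.1 ∈ w.map Prod.fst := fun z hz =>
        hsub _ (List.mem_map_of_mem hz)
      have hxm : x.1 ∈ w.map Prod.fst := List.mem_map_of_mem (hperm.mem_iff.2 (by simp))
      have hym : y.1 ∈ w.map Prod.fst := List.mem_map_of_mem (hperm.mem_iff.2 (by simp))
      -- the two new words
      let U := p ++ ([x] ++ (invRev r ++ (invRev s ++ invRev p)))
      let W := p ++ (s ++ (r ++ (q ++ ([y] ++ (invRev s ++ invRev p)))))
      have hlw : w'.length = p.length + (s.length + (r.length + (q.length + t.length))) := by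
        simp [hw'def]
      have hinv : ∀ (l : List (β × Bool)), (∀ z ∈ l, z.1 ∈ w.map Prod.fst) →
          ∀ z ∈ invRev l, z.1 ∈ w.map Prod.fst := by
        intro l hl z hz
        simp only [invRev, List.mem_reverse, List.mem_map] at hz
        obtain ⟨a, ha, rfl⟩ := hz
        exact hl a ha
      have mp : ∀ z ∈ p, z.1 ∈ w.map Prod.fst := fun z hz => hmem z (by simp [hw'def, hz])
      have ms : ∀ z ∈ s, z.1 ∈ w.map Prod.fst := fun z hz => hmem z (by simp [hw'def, hz])
      have mr : ∀ z ∈ r, z.1 ∈ w.map Prod.fst := fun z hz => hmem z (by simp [hw'def, hz])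
      have mq : ∀ z ∈ q, z.1 ∈ w.map Prod.fst := fun z hz => hmem z (by simp [hw'def, hz])
      refine ⟨(U, W) :: H, ?_, ?_, ?_, ?_, ?_⟩
      · have hw'' : w = p ++ ([x] ++ (q ++ ([y] ++ (r ++ ([nx x] ++ (s ++ ([nx y] ++ t))))))) := by
          simpa using hw'
        rw [List.map_cons, List.prod_cons, ← e1, hw'', hw'def]
        simp only [U, W, mk_app, mk_nx, mk_invRev]
        group
      · intro z hz
        rcases List.mem_cons.1 hz with rfl | hz
        · simp only [U, W, List.length_append, List.length_singleton, invRev_length]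
          omega
        · have := e2 z hz
          omega
      · intro z hz
        rcases List.mem_cons.1 hz with rfl | hz
        · constructor
          · intro a ha
            simp only [U, List.mem_append, List.mem_singleton] at ha
            rcases ha with h | rfl | h | h | h
            · exact mp _ h
            · exact hxm
            · exact hinv r mr _ h
            · exact hinv s ms _ h
            · exact hinv p mp _ h
          · intro a ha
            simp only [W, List.mem_append, List.mem_singleton] at ha
            rcases ha with h | h | h | h | rfl | h | h
            · exact mp _ h
            · exact ms _ h
            · exact mr _ h
            · exact mq _ h
            · exact hym
            · exact hinv s ms _ h
            · exact hinv p mp _ h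
        · exact ⟨fun a ha => hsub _ ((e3 z hz).1 a ha), fun a ha => hsub _ ((e3 z hz).2 a ha)⟩
      · simp; omega
      · intro G _ H' hH'
        rcases H' with _ | ⟨⟨u0, w0⟩, H'⟩
        · simp at hH'
        obtain ⟨f, hf⟩ := e5 G H' (by simpa using hH')
        let P := lift f (mk p)
        let S := lift f (mk s)
        let R := lift f (mk r)
        let Qv := lift f (mk q)
        let xv := P⁻¹ * u0 * P * S * R
        let yv := (P * S * R * Qv)⁻¹ * w0 * P * S
        let f1 := Function.update f x.1 (cond x.2 xv xv⁻¹)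
        let f2 := Function.update f1 y.1 (cond y.2 yv yv⁻¹)
        have agree : ∀ l : List (β × Bool), (∀ z ∈ l, z.1 ∈ w'.map Prod.fst) →
            lift f2 (mk l) = lift f (mk l) := by
          intro l hl
          apply lift_congr
          intro z hz
          obtain ⟨z', hz', he⟩ := List.mem_map.1 (hl z hz)
          have h1 : z.1 ≠ x.1 := he ▸ hxw z' hz'
          have h2 : z.1 ≠ y.1 := he ▸ hyw z' hz'
          simp [f2, f1, Function.update_of_ne, h1, h2]
        have fx : lift f2 (mk [x]) = xv := by
          rw [← lift_letter f x xv]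
          apply lift_congr
          intro z hz
          have : z = x := by simpa using hz
          subst this
          simp only [f2]
          rw [Function.update_of_ne hxy.symm]
        have fy : lift f2 (mk [y]) = yv := lift_letter f1 y yv
        have ap : lift f2 (mk p) = P := agree p fun z hz =>
          List.mem_map_of_mem (by simp [hw'def, hz])
        have as : lift f2 (mk s) = S := agree s fun z hz =>
          List.mem_map_of_mem (by simp [hw'def, hz])
        have ar : lift f2 (mk r) = R := agree r fun z hz =>
          List.mem_map_of_mem (by simp [hw'def, hz])
        have aq : lift f2 (mk q) = Qv := agree q fun z hz =>
          List.mem_map_of_mem (by simp [hw'def, hz])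
        refine ⟨f2, ?_⟩
        rw [List.map_cons]
        congr 1
        · simp only [U, W, mk_app, mk_invRev, _root_.map_mul, _root_.map_inv, fx, fy,
            ap, as, ar, aq, xv, yv]
          ext
          · simp only; group
          · simp only; group
        · rw [← hf]
          apply List.map_congr_left
          intro z hz
          rw [agree _ (e3 z hz).1, agree _ (e3 z hz).2]

end words
end QE

namespace QE
open FreeGroup
section words2
variable {β : Type*} [DecidableEq β]

@[simp] theorem cnt_nil (b : β) : cnt b [] = 0 := rfl
theorem cnt_app (b : β) (u v : List (β × Bool)) : cnt b (u ++ v) = cnt b u + cnt b v := by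
  simp [cnt, List.count_append]
theorem cnt_cons (b : β) (x : β × Bool) (v : List (β × Bool)) :
    cnt b (x :: v) = cnt b v + if x.1 = b then 1 else 0 := by
  simp [cnt, List.count_cons]
theorem cnt_perm {u v : List (β × Bool)} (h : u.Perm v) (b : β) : cnt b u = cnt b v :=
  (h.map _).count_eq b
theorem cnt_invRev (b : β) (v : List (β × Bool)) : cnt b (invRev v) = cnt b v := by
  induction v with
  | nil => rfl
  | cons x v ih =>
    have : invRev (x :: v) = invRev v ++ [nx x] := by simp [invRev, nx]
    rw [this, cnt_app, ih, cnt_cons, cnt_cons]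
    simp only [cnt_nil, zero_add]
    rfl
theorem cnt_count (b : β) (v : List (β × Bool)) :
    cnt b v = v.count (b, true) + v.count (b, false) := by
  induction v with
  | nil => rfl
  | cons x v ih =>
    rcases x with ⟨a, s⟩
    rw [cnt_cons, ih]
    by_cases h : a = b <;> cases s <;> simp [h] <;> omega
theorem cnt_pos {b : β} {v : List (β × Bool)} (h : 0 < cnt b v) : ∃ x ∈ v, x.1 = b := by
  have := List.count_pos_iff.1 h
  simpa using this
theorem cnt_pos' {x : β × Bool} {v : List (β × Bool)} (h : x ∈ v) : 0 < cnt x.1 v :=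
  List.count_pos_iff.2 (List.mem_map_of_mem h)

theorem nfY : ∀ n (w : List (β × Bool)), w.length ≤ n →
    (∀ b, cnt b w = 0 ∨ cnt b w = 2) →
    ∃ (Y : List (List (β × Bool))) (H : List (List (β × Bool) × List (β × Bool))),
      mk w = (Y.map fun y => mk y ^ 2).prod *
        (H.map fun p => mk p.1 * mk p.2 * (mk p.1)⁻¹ * (mk p.2)⁻¹).prod ∧
      (∀ y ∈ Y, y.length ≤ 2 * w.length) ∧
      (∀ p ∈ H, p.1.length ≤ 2 * w.length ∧ p.2.length ≤ 2 * w.length) ∧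
      (∀ y ∈ Y, ∀ x ∈ y, x.1 ∈ w.map Prod.fst) ∧
      (∀ p ∈ H, (∀ x ∈ p.1, x.1 ∈ w.map Prod.fst) ∧ (∀ x ∈ p.2, x.1 ∈ w.map Prod.fst)) ∧
      2 * Y.length + 4 * H.length ≤ w.length ∧
      (∀ (G : Type) [Group G] (Y' : List G) (H' : List (G × G)), Y'.length = Y.length →
        H'.length = H.length →
        ∃ f : β → G, Y.map (fun y => lift f (mk y)) = Y' ∧
          H.map (fun p => (lift f (mk p.1), lift f (mk p.2))) = H') := by
  intro n
  induction n with
  | zero =>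
    intro w hw _
    have : w = [] := List.eq_nil_of_length_eq_zero (by omega)
    subst this
    exact ⟨[], [], by simp [mk_nil], by simp, by simp, by simp, by simp, by simp,
      fun G _ Y' H' h h' => ⟨fun _ => 1, by simpa using (List.eq_nil_of_length_eq_zero h).symm,
        by simpa using (List.eq_nil_of_length_eq_zero h').symm⟩⟩
  | succ n ih =>
    intro w hw hc
    by_cases hn : w.Nodup
    · obtain ⟨H, e1, e2, e3, e4, e5⟩ := nfH _ w le_rfl hn (by
        intro z hz
        have h1 : cnt z.1 w = 2 := by
          have := cnt_pos' hz
          have := hc z.1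
          omega
        rw [cnt_count] at h1
        have h2 := List.nodup_iff_count_le_one.1 hn (z.1, true)
        have h3 := List.nodup_iff_count_le_one.1 hn (z.1, false)
        have h4 : 0 < w.count (nx z) := by
          rcases z with ⟨b, s⟩
          cases s <;> simp only [nx, Bool.not_true, Bool.not_false] <;> simp only at h1 h2 h3 <;>
            omega
        exact List.count_pos_iff.1 h4)
      refine ⟨[], H, by simpa using e1, by simp, e2, by simp, e3, by simpa using e4, ?_⟩
      intro G _ Y' H' hY hH
      obtain ⟨f, hf⟩ := e5 G H' hH
      exact ⟨f, by simpa using (List.eq_nil_of_length_eq_zero hY).symm, hf⟩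
    · obtain ⟨p, x, q, r, hw'⟩ := exists_dup hn
      set w' := p ++ (invRev q ++ r) with hw'def
      have hcnt : ∀ b, cnt b w = cnt b w' + if x.1 = b then 2 else 0 := by
        intro b
        rw [hw', hw'def]
        simp only [cnt_app, cnt_cons, cnt_invRev]
        split_ifs <;> omega
      have hlen : w.length = w'.length + 2 := by
        simp [hw', hw'def, invRev_length]; omega
      have hxw : ∀ z ∈ w', z.1 ≠ x.1 := by
        intro z hz h
        have h1 := cnt_pos' hz
        have h2 := hcnt z.1
        rw [if_pos h.symm] at h2
        have := hc z.1
        omega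
      obtain ⟨Y, H, e1, e2, e2', e3, e3', e4, e5⟩ := ih w' (by omega) (by
        intro b
        have h1 := hcnt b
        have h2 := hc b
        split_ifs at h1 <;> omega)
      have hsub : ∀ a, a ∈ w'.map Prod.fst → a ∈ w.map Prod.fst := by
        intro a ha
        have h1 : 0 < cnt a w' := List.count_pos_iff.2 ha
        have h2 := hcnt a
        exact List.count_pos_iff.1 (show 0 < cnt a w by omega)
      have mem_q : ∀ z ∈ q, z.1 ∈ w'.map Prod.fst := by
        intro z hz
        refine List.count_pos_iff.1 (show 0 < cnt z.1 w' from ?_)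
        have := cnt_pos' hz
        rw [hw'def, cnt_app, cnt_app, cnt_invRev]
        omega
      have mem_p : ∀ z ∈ p, z.1 ∈ w'.map Prod.fst := fun z hz =>
        List.mem_map_of_mem (by simp [hw'def, hz])
      have mem_p' : ∀ z ∈ invRev p, z.1 ∈ w'.map Prod.fst := by
        intro z hz
        simp only [invRev, List.mem_reverse, List.mem_map] at hz
        obtain ⟨a, ha, rfl⟩ := hz
        exact mem_p a ha
      have hxm : x.1 ∈ w.map Prod.fst := List.mem_map_of_mem (by rw [hw']; simp)
      let U := p ++ ([x] ++ (q ++ invRev p))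
      have hlw : w'.length = p.length + (q.length + r.length) := by
        simp [hw'def, invRev_length]
      refine ⟨U :: Y, H, ?_, ?_, ?_, ?_, ?_, ?_, ?_⟩
      · have hw'' : w = p ++ ([x] ++ (q ++ ([x] ++ r))) := by simpa using hw'
        rw [List.map_cons, List.prod_cons, mul_assoc, ← e1, hw'', hw'def]
        simp only [U, mk_app, mk_invRev, pow_two]
        group
      · intro z hz
        rcases List.mem_cons.1 hz with rfl | hz
        · simp only [U, List.length_append, List.length_singleton, invRev_length]
          omega
        · have := e2 z hz
          omega
      · intro z hz
        have := e2' z hz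
        omega
      · intro z hz
        rcases List.mem_cons.1 hz with rfl | hz
        · intro a ha
          simp only [U, List.mem_append, List.mem_singleton] at ha
          rcases ha with h | rfl | h | h
          · exact hsub _ (mem_p _ h)
          · exact hxm
          · exact hsub _ (mem_q _ h)
          · exact hsub _ (mem_p' _ h)
        · exact fun a ha => hsub _ (e3 z hz a ha)
      · exact fun z hz => ⟨fun a ha => hsub _ ((e3' z hz).1 a ha),
          fun a ha => hsub _ ((e3' z hz).2 a ha)⟩
      · simp; omega
      · intro G _ Y' H' hY' hH'
        rcases Y' with _ | ⟨u0, Y'⟩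
        · simp at hY'
        obtain ⟨f, hf, hf'⟩ := e5 G Y' H' (by simpa using hY') hH'
        let P := lift f (mk p)
        let Qv := lift f (mk q)
        let xv := P⁻¹ * u0 * P * Qv⁻¹
        let f1 := Function.update f x.1 (cond x.2 xv xv⁻¹)
        have agree : ∀ l : List (β × Bool), (∀ z ∈ l, z.1 ∈ w'.map Prod.fst) →
            lift f1 (mk l) = lift f (mk l) := by
          intro l hl
          apply lift_congr
          intro z hz
          obtain ⟨z', hz', he⟩ := List.mem_map.1 (hl z hz)
          have h1 : z.1 ≠ x.1 := he ▸ hxw z' hz'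
          simp [f1, Function.update_of_ne, h1]
        have fx : lift f1 (mk [x]) = xv := lift_letter f x xv
        have ap : lift f1 (mk p) = P := agree p mem_p
        have aq : lift f1 (mk q) = Qv := agree q mem_q
        refine ⟨f1, ?_, ?_⟩
        · rw [List.map_cons]
          congr 1
          · simp only [U, mk_app, mk_invRev, _root_.map_mul, _root_.map_inv, fx, ap, aq, xv]
            group
          · rw [← hf]
            apply List.map_congr_left
            intro z hz
            rw [agree _ (e3 z hz)]
        · rw [← hf']
          apply List.map_congr_left
          intro z hz
          rw [agree _ (e3' z hz).1, agree _ (e3' z hz).2]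

end words2
end QE

namespace QE
open FreeGroup

/-- The value of an item: a signed conjugate of a coefficient. -/
def val {G : Type*} [Group G] (t : G × Bool × G) : G :=
  t.2.2⁻¹ * (cond t.2.1 t.1 t.1⁻¹) * t.2.2

/-- Solvability (up to order and signs) of the quadratic equation with coefficient list `L`. -/
def Solv {G : Type*} [Group G] (g : ℕ) (L : List G) : Prop :=
  ∃ xs : List G, xs.length = g ∧ ∃ T : List (G × Bool × G), (T.map Prod.fst).Perm L ∧
    (xs.map (· ^ 2)).prod * (T.map val).prod = 1

/-- A class two group: vectors and matrices over the field with two elements. -/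
@[ext] structure HG (ι : Type) where
  v : ι → ZMod 2
  A : Matrix ι ι (ZMod 2)

namespace HG
variable {ι : Type}

instance : Mul (HG ι) := ⟨fun a b => ⟨a.v + b.v, a.A + b.A + Matrix.vecMulVec a.v b.v⟩⟩
instance : One (HG ι) := ⟨⟨0, 0⟩⟩
instance : Inv (HG ι) := ⟨fun a => ⟨a.v, -a.A - Matrix.vecMulVec a.v a.v⟩⟩

theorem mul_def (a b : HG ι) : a * b = ⟨a.v + b.v, a.A + b.A + Matrix.vecMulVec a.v b.v⟩ := rfl
theorem one_def : (1 : HG ι) = ⟨0, 0⟩ := rfl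
theorem inv_def (a : HG ι) : a⁻¹ = ⟨a.v, -a.A - Matrix.vecMulVec a.v a.v⟩ := rfl

instance : Group (HG ι) := Group.ofLeftAxioms
  (by
    intro a b c
    ext i j
    · simp [mul_def, add_assoc]
    · simp [mul_def, Matrix.vecMulVec_apply]; ring)
  (by intro a; ext i j <;> simp [mul_def, one_def])
  (by
    intro a
    ext i j
    · simp only [mul_def, inv_def, one_def, Pi.add_apply]; exact CharTwo.add_self_eq_zero _
    · simp only [mul_def, inv_def, one_def, Matrix.vecMulVec_apply, Matrix.add_apply,
        Matrix.sub_apply, Matrix.neg_apply, Matrix.zero_apply]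
      ring)

theorem sq (a : HG ι) : a ^ 2 = ⟨0, Matrix.vecMulVec a.v a.v⟩ := by
  rw [pow_two]
  ext i j
  · simp only [mul_def, Pi.add_apply]; exact CharTwo.add_self_eq_zero _
  · simp only [mul_def, Matrix.add_apply]; rw [CharTwo.add_self_eq_zero, zero_add]

theorem comm (a b : HG ι) : a * b * a⁻¹ * b⁻¹ =
    ⟨0, Matrix.vecMulVec a.v b.v + Matrix.vecMulVec b.v a.v⟩ := by
  have h : ∀ x y : HG ι, y.v = 0 → (y * x).v = x.v ∧ (y * x).A = y.A + x.A := by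
    intro x y h; simp [mul_def, h]
  have key : a * b = (⟨0, Matrix.vecMulVec a.v b.v + Matrix.vecMulVec b.v a.v⟩ : HG ι) * (b * a) := by
    ext i j
    · simp [mul_def, add_comm]
    · simp only [mul_def, Matrix.add_apply, Matrix.vecMulVec_apply, Pi.zero_apply, Pi.add_apply]
      have := CharTwo.add_self_eq_zero (b.v i * a.v j)
      linear_combination -this
  rw [key]; group

theorem mul_v (a b : HG ι) : (a * b).v = a.v + b.v := rfl
theorem inv_v (a : HG ι) : (a⁻¹).v = a.v := rfl

theorem prod_central (l : List (HG ι)) (h : ∀ a ∈ l, a.v = 0) :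
    l.prod = ⟨0, (l.map HG.A).sum⟩ := by
  induction l with
  | nil => rfl
  | cons a l ih =>
    rw [List.prod_cons, ih fun b hb => h b (by simp [hb]), mul_def, h a (by simp)]
    simp

theorem conj_central (c z : HG ι) (h : c.v = 0) (s : Bool) : z⁻¹ * (cond s c c⁻¹) * z = c := by
  have hinv : c⁻¹ = c := by
    rw [inv_def, h]
    ext i j
    · simp [h]
    · simp only [Matrix.sub_apply, Matrix.neg_apply, Matrix.vecMulVec_apply, Pi.zero_apply]
      simp [ZModModule.neg_eq_self]
  have : cond s c c⁻¹ = c := by cases s <;> simp [hinv]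
  rw [this]
  have hc : c * z = z * c := by
    ext i j
    · simp [mul_def, h]
    · simp [mul_def, h, add_comm]
  rw [mul_assoc, hc]; group

end HG

/-- Evaluating a word with even letter counts gives an element with zero vector part. -/
theorem lift_even_v {β : Type*} [DecidableEq β] {ι : Type} (f : β → HG ι) (w : List (β × Bool))
    (h : ∀ b, Even (cnt b w)) : (lift f (mk w)).v = 0 := by
  have h1 : (lift f (mk w)).v = ((w.map Prod.fst).map fun b => (f b).v).sum := by
    rw [lift_mk]
    clear h
    induction w with
    | nil => rfl
    | cons x w ih =>
      simp only [List.map_cons, List.prod_cons, List.sum_cons, HG.mul_v, ih]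
      rcases x with ⟨b, s⟩
      cases s <;> simp [HG.inv_v]
  rw [h1, Finset.sum_list_map_count]
  apply Finset.sum_eq_zero
  intro b _
  obtain ⟨k, hk⟩ := h b
  unfold cnt at hk
  rw [hk]
  ext i
  rw [add_smul]
  exact CharTwo.add_self_eq_zero _

theorem matrix_bound {ι : Type} [Fintype ι] [DecidableEq ι] (E : Matrix ι ι (ZMod 2))
    (hE : E * E = 1) (vs : List (ι → ZMod 2))
    (h : E = (vs.map fun v => Matrix.vecMulVec v v).sum) :
    Fintype.card ι ≤ vs.length ∧
      ((∀ i, E i i = 0) → 1 ≤ vs.length → Fintype.card ι + 1 ≤ vs.length) := by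
  let X : Matrix ι (Fin vs.length) (ZMod 2) := fun i j => vs.get j i
  have hX : E = X * X.transpose := by
    rw [h]
    ext i j
    rw [Matrix.mul_apply, ← List.sum_ofFn]
    have : (List.map (fun v => Matrix.vecMulVec v v) vs).sum i j =
        (vs.map fun v => v i * v j).sum := by
      clear h X
      induction vs with
      | nil => rfl
      | cons v vs ih => simp [Matrix.vecMulVec_apply, ih]
    rw [this]
    congr 1
    conv_lhs => rw [← List.ofFn_get vs, List.map_ofFn]
    rfl
  have hr : E.rank = Fintype.card ι :=
    Matrix.rank_of_isUnit E ⟨⟨E, E, hE, hE⟩, rfl⟩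
  have hr2 : Fintype.card ι ≤ X.rank := by
    rw [← hr, hX]; exact Matrix.rank_mul_le_left _ _
  have hr3 : X.rank ≤ vs.length := by simpa using X.rank_le_card_width
  refine ⟨hr2.trans hr3, ?_⟩
  intro hd h1
  by_contra hlt
  have hfull : X.rank = vs.length := by omega
  have hker : X.mulVecLin.ker = ⊥ := by
    have := LinearMap.finrank_range_add_finrank_ker X.mulVecLin
    rw [Module.finrank_fin_fun] at this
    have h2 : Module.finrank (ZMod 2) X.mulVecLin.ker = 0 := by
      have : X.rank = Module.finrank (ZMod 2) X.mulVecLin.range := rfl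
      omega
    exact Submodule.finrank_eq_zero.1 h2
  have hone : (fun _ => 1 : Fin vs.length → ZMod 2) ∈ X.mulVecLin.ker := by
    rw [LinearMap.mem_ker]
    ext i
    have := hd i
    rw [hX, Matrix.mul_apply] at this
    rw [Matrix.mulVecLin_apply, Matrix.mulVec, dotProduct, Pi.zero_apply, ← this]
    apply Finset.sum_congr rfl
    intro j _
    rw [Matrix.transpose_apply]
    generalize X i j = a
    revert a; decide
  rw [hker, Submodule.mem_bot] at hone
  have := congrFun hone ⟨0, h1⟩
  simp at this

/-- The involution on the index set of the normal form. -/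
def tau {k h : ℕ} : Fin k ⊕ (Fin h × Bool) → Fin k ⊕ (Fin h × Bool)
  | Sum.inl i => Sum.inl i
  | Sum.inr (j, s) => Sum.inr (j, !s)

theorem tau_tau {k h : ℕ} (a : Fin k ⊕ (Fin h × Bool)) : tau (tau a) = a := by
  rcases a with i | ⟨j, s⟩ <;> simp [tau]

theorem E_entry {k h : ℕ} (a b : Fin k ⊕ (Fin h × Bool)) :
    (∑ i : Fin k, (Pi.single (Sum.inl i) 1 : Fin k ⊕ (Fin h × Bool) → ZMod 2) a *
      (Pi.single (Sum.inl i) 1 : Fin k ⊕ (Fin h × Bool) → ZMod 2) b) +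
    (∑ j : Fin h, (Pi.single (Sum.inr (j, true)) 1 : Fin k ⊕ (Fin h × Bool) → ZMod 2) a *
      (Pi.single (Sum.inr (j, false)) 1 : Fin k ⊕ (Fin h × Bool) → ZMod 2) b +
    ∑ j : Fin h, (Pi.single (Sum.inr (j, false)) 1 : Fin k ⊕ (Fin h × Bool) → ZMod 2) a *
      (Pi.single (Sum.inr (j, true)) 1 : Fin k ⊕ (Fin h × Bool) → ZMod 2) b) =
    if b = tau a then 1 else 0 := by
  rcases a with i | ⟨j, s⟩ <;> rcases b with i' | ⟨j', s'⟩
  · simp [tau, Pi.single_apply, eq_comm]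
  · simp [tau, Pi.single_apply]
  · simp [tau, Pi.single_apply]
  · cases s <;> cases s' <;> simp [tau, Pi.single_apply, eq_comm]

theorem tau_ne {k h : ℕ} (j : Fin h) (s : Bool) :
    (Sum.inr (j, s) : Fin k ⊕ (Fin h × Bool)) ≠ tau (Sum.inr (j, s)) := by
  cases s <;> simp [tau]

theorem lower_bound {β : Type*} [DecidableEq β] {g : ℕ} (hg : 1 ≤ g) (cs : List (List (β × Bool)))
    (hev : ∀ c ∈ cs, ∀ b, Even (cnt b c)) (hS : Solv g (cs.map mk))
    (Y : List (List (β × Bool))) (H : List (List (β × Bool) × List (β × Bool)))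
    (hQ : mk cs.flatten = (Y.map fun y => mk y ^ 2).prod *
        (H.map fun p => mk p.1 * mk p.2 * (mk p.1)⁻¹ * (mk p.2)⁻¹).prod)
    (hU : ∀ (G : Type) [Group G] (Y' : List G) (H' : List (G × G)), Y'.length = Y.length →
        H'.length = H.length →
        ∃ f : β → G, Y.map (fun y => lift f (mk y)) = Y' ∧
          H.map (fun p => (lift f (mk p.1), lift f (mk p.2))) = H') :
    Y.length + 2 * H.length ≤ g ∧ (Y = [] → 2 * H.length + 1 ≤ g) := by
  classical
  obtain ⟨xs, hxs, T, hT, heq⟩ := hS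
  generalize hk : Y.length = k at *
  generalize hh : H.length = h at *
  let ι := Fin k ⊕ (Fin h × Bool)
  let e : ι → HG ι := fun a => ⟨Pi.single a 1, 0⟩
  obtain ⟨f, hf1, hf2⟩ := hU (HG ι) (List.ofFn fun i : Fin k => e (Sum.inl i))
    (List.ofFn fun j : Fin h => (e (Sum.inr (j, true)), e (Sum.inr (j, false)))) (by simp)
    (by simp)
  let φ := lift f
  let E : Matrix ι ι (ZMod 2) := Matrix.of fun a b => if b = tau a then 1 else 0
  have hφQ : φ (mk cs.flatten) = ⟨0, E⟩ := by
    rw [hQ, _root_.map_mul, map_list_prod, map_list_prod]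
    have h1 : (Y.map fun y => mk y ^ 2).map φ =
        List.ofFn fun i : Fin k => (⟨0, Matrix.vecMulVec (Pi.single (Sum.inl i) 1)
          (Pi.single (Sum.inl i) 1)⟩ : HG ι) := by
      rw [List.map_map]
      have : (φ ∘ fun y => mk y ^ 2) = (fun a : HG ι => a ^ 2) ∘ (fun y => lift f (mk y)) := by
        funext y; simp only [Function.comp, _root_.map_pow, φ]
      rw [this, ← List.map_map, hf1, List.map_ofFn]
      congr 1; funext i; simp [HG.sq, e]
    have h2 : (H.map fun p => mk p.1 * mk p.2 * (mk p.1)⁻¹ * (mk p.2)⁻¹).map φ =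
        List.ofFn fun j : Fin h => (⟨0, Matrix.vecMulVec (Pi.single (Sum.inr (j, true)) 1)
          (Pi.single (Sum.inr (j, false)) 1) + Matrix.vecMulVec (Pi.single (Sum.inr (j, false)) 1)
          (Pi.single (Sum.inr (j, true)) 1)⟩ : HG ι) := by
      rw [List.map_map]
      have : (φ ∘ fun p : List (β × Bool) × List (β × Bool) =>
          mk p.1 * mk p.2 * (mk p.1)⁻¹ * (mk p.2)⁻¹) =
          (fun a : HG ι × HG ι => a.1 * a.2 * a.1⁻¹ * a.2⁻¹) ∘
          (fun p => (lift f (mk p.1), lift f (mk p.2))) := by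
        funext y; simp only [Function.comp, _root_.map_mul, _root_.map_inv, φ]
      rw [this, ← List.map_map, hf2, List.map_ofFn]
      congr 1; funext i; simp only [Function.comp, HG.comm, e]
    rw [h1, h2, HG.prod_central, HG.prod_central, HG.mul_def]
    · ext a b
      · simp
      · simp only [List.map_ofFn, List.sum_ofFn, Matrix.vecMulVec_zero,
          Matrix.add_apply, Matrix.sum_apply, Function.comp, Matrix.vecMulVec_apply, E,
          Matrix.of_apply, Finset.sum_add_distrib]
        rw [Matrix.zero_apply, add_zero]
        convert E_entry a b
    · intro a ha
      obtain ⟨i, rfl⟩ := List.mem_ofFn.1 ha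
      rfl
    · intro a ha
      obtain ⟨i, rfl⟩ := List.mem_ofFn.1 ha
      rfl
  have hφT : φ (T.map val).prod = φ (mk cs.flatten) := by
    have hv : ∀ c ∈ cs.map mk, (φ c).v = 0 := by
      intro c hc
      obtain ⟨w, hw, rfl⟩ := List.mem_map.1 hc
      exact lift_even_v f w (hev w hw)
    have hfl : mk cs.flatten = (cs.map mk).prod := by
      clear * -
      induction cs with
      | nil => rfl
      | cons c cs ih => rw [List.flatten_cons, mk_app, ih]; simp
    rw [hfl, map_list_prod, map_list_prod]
    have h1 : (T.map val).map φ = (T.map Prod.fst).map φ := by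
      rw [List.map_map, List.map_map]
      apply List.map_congr_left
      intro t ht
      have : (φ t.1).v = 0 := hv _ (hT.mem_iff.1 (List.mem_map_of_mem ht))
      have := HG.conj_central (φ t.1) (φ t.2.2) this t.2.1
      simp only [Function.comp, val, _root_.map_mul, _root_.map_inv]
      cases hs : t.2.1 <;> simpa [hs] using this
    rw [h1, HG.prod_central, HG.prod_central]
    · rw [((hT.map φ).map HG.A).sum_eq]
    · intro a ha
      obtain ⟨c, hc, rfl⟩ := List.mem_map.1 ha
      exact hv c hc
    · intro a ha
      obtain ⟨c, hc, rfl⟩ := List.mem_map.1 ha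
      exact hv c (hT.mem_iff.1 hc)
  have hmain : E = ((xs.map fun x => (φ x).v).map fun v => Matrix.vecMulVec v v).sum := by
    have h1 := congrArg φ heq
    rw [_root_.map_mul, hφT, hφQ, map_list_prod, _root_.map_one, HG.prod_central, HG.mul_def,
      HG.one_def] at h1
    · have h2 := congrArg HG.A h1
      simp only [Matrix.vecMulVec_zero, add_zero, List.map_map] at h2
      have h3 := eq_neg_of_add_eq_zero_right h2
      rw [h3]
      have : ∀ M : Matrix ι ι (ZMod 2), -M = M := by
        intro M; ext i j; simp [ZModModule.neg_eq_self]
      rw [this, List.map_map]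
      congr 1
      apply List.map_congr_left
      intro x _
      simp [HG.sq]
    · intro a ha
      simp only [List.map_map, List.mem_map] at ha
      obtain ⟨c, hc, rfl⟩ := ha
      simp [HG.sq]
  have hEE : E * E = 1 := by
    ext a b
    rw [Matrix.mul_apply, Finset.sum_eq_single (tau a)]
    · simp [E, tau_tau, Matrix.one_apply, eq_comm]
    · intro c _ hc
      simp [E, hc]
    · simp
  have := matrix_bound E hEE _ hmain
  simp only [List.length_map, hxs, Fintype.card_sum, Fintype.card_fin, Fintype.card_prod,
    Fintype.card_bool, ι] at this
  refine ⟨by omega, ?_⟩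
  intro hY
  have hk0 : k = 0 := by rw [← hk, hY]; rfl
  have := this.2 (by
    rintro (i | ⟨j, s⟩)
    · subst hk0; exact i.elim0
    · exact if_neg (tau_ne j s)) hg
  omega
end QE

namespace QE
open FreeGroup
section conv
variable {β : Type*} [DecidableEq β]

theorem norm_sq_bound {a b c d : FreeGroup β} : (a * b * c * d).norm ≤
    a.norm + b.norm + c.norm + d.norm := by
  have h1 := norm_mul_le (a * b * c) d
  have h2 := norm_mul_le (a * b) c
  have h3 := norm_mul_le a b
  omega

/-- One square followed by commutators is a product of squares. -/
theorem conv (N : ℕ) : ∀ (H : List (FreeGroup β × FreeGroup β)) (T : ℕ) (t : FreeGroup β),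
    t.norm ≤ T → (∀ p ∈ H, p.1.norm ≤ N ∧ p.2.norm ≤ N) →
    ∃ xs : List (FreeGroup β), xs.length = 1 + 2 * H.length ∧
      t ^ 2 * (H.map fun p => p.1 * p.2 * p.1⁻¹ * p.2⁻¹).prod = (xs.map (· ^ 2)).prod ∧
      ∀ x ∈ xs, x.norm ≤ 3 * (T + 2 * N * H.length) + N := by
  intro H
  induction H with
  | nil =>
    intro T t ht _
    refine ⟨[t], by simp, by simp, ?_⟩
    intro x hx
    have : x = t := by simpa using hx
    subst this
    omega
  | cons p H ih =>
    intro T y hy hH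
    obtain ⟨hu, hw⟩ := hH p (by simp)
    obtain ⟨u, w⟩ := p
    simp only at hu hw
    have ht : (y * u * w).norm ≤ T + 2 * N := by
      have h1 := norm_mul_le (y * u) w
      have h2 := norm_mul_le y u
      omega
    obtain ⟨xs, e1, e2, e3⟩ := ih (T + 2 * N) (y * u * w) ht fun p hp => hH p (by simp [hp])
    have hmul : 2 * N * (((u, w) :: H).length) = 2 * N * H.length + 2 * N := by
      rw [List.length_cons]; ring
    refine ⟨(y * (y * u * w) * w * (y * u * w)⁻¹) ::
      ((y * u * w) * w⁻¹ * (y * u * w)⁻¹ * (y * u * w)⁻¹) :: xs, ?_, ?_, ?_⟩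
    · simp [e1]; ring
    · simp only [List.map_cons, List.prod_cons]
      rw [← e2]
      simp only [pow_two]
      group
    · intro x hx
      rw [hmul]
      rcases List.mem_cons.1 hx with rfl | hx
      · have h1 := @norm_sq_bound β _ y (y * u * w) w (y * u * w)⁻¹
        rw [norm_inv_eq] at h1
        omega
      rcases List.mem_cons.1 hx with rfl | hx
      · have h1 := @norm_sq_bound β _ (y * u * w) w⁻¹ (y * u * w)⁻¹ (y * u * w)⁻¹
        rw [norm_inv_eq, norm_inv_eq] at h1
        omega
      · have := e3 x hx
        omega

/-- Bound on the squares in the base case. -/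
def XB (S : ℕ) : ℕ := 2 * S + 20 * S * (S / 4)

theorem base_squares {g : ℕ} (hg : 1 ≤ g) (cs : List (List (β × Bool)))
    (hev : ∀ c ∈ cs, ∀ b, Even (cnt b c)) (hcnt : ∀ b, cnt b cs.flatten = 0 ∨ cnt b cs.flatten = 2)
    (hS : Solv g (cs.map mk)) (S : ℕ) (hlen : cs.flatten.length ≤ S) :
    ∃ xs : List (FreeGroup β), xs.length = g ∧ mk cs.flatten = (xs.map (· ^ 2)).prod ∧
      ∀ x ∈ xs, x.norm ≤ XB S := by
  obtain ⟨Y, H, e1, e2, e2', -, -, e4, e5⟩ := nfY _ cs.flatten le_rfl hcnt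
  obtain ⟨b1, b2⟩ := lower_bound hg cs hev hS Y H e1 e5
  have hH : ∀ p ∈ H.map (fun p => (mk p.1, mk p.2)), p.1.norm ≤ 2 * S ∧ p.2.norm ≤ 2 * S := by
    intro p hp
    obtain ⟨q, hq, rfl⟩ := List.mem_map.1 hp
    have h1 := e2' q hq
    have h2 := norm_mk_le (L₁ := q.1)
    have h3 := norm_mk_le (L₁ := q.2)
    simp only
    omega
  have hHlen : H.length ≤ S / 4 := by omega
  have hcomm : (H.map fun p => mk p.1 * mk p.2 * (mk p.1)⁻¹ * (mk p.2)⁻¹) =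
      (H.map (fun p => (mk p.1, mk p.2))).map fun p => p.1 * p.2 * p.1⁻¹ * p.2⁻¹ := by
    rw [List.map_map]; rfl
  have hmulS : S * H.length ≤ S * (S / 4) := Nat.mul_le_mul_left _ hHlen
  -- a general statement: `t ^ 2` times the commutators
  have key : ∀ t : FreeGroup β, t.norm ≤ 2 * S → (H = [] → t ≠ 1 → True) →
      ∃ xs : List (FreeGroup β), xs.length = 1 + 2 * H.length ∧
      t ^ 2 * (H.map fun p => mk p.1 * mk p.2 * (mk p.1)⁻¹ * (mk p.2)⁻¹).prod =
        (xs.map (· ^ 2)).prod ∧ ∀ x ∈ xs, x.norm ≤ XB S := by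
    intro t ht _
    rcases Nat.eq_zero_or_pos H.length with h0 | h0
    · have : H = [] := List.eq_nil_of_length_eq_zero h0
      subst this
      refine ⟨[t], by simp, by simp, ?_⟩
      intro x hx
      have : x = t := by simpa using hx
      subst this
      unfold XB
      omega
    · obtain ⟨xs, h1, h2, h3⟩ := conv (2 * S) _ (2 * S) t ht hH
      rw [← hcomm] at h2
      rw [List.length_map] at h1 h3
      refine ⟨xs, h1, h2, fun x hx => (h3 x hx).trans ?_⟩
      have h4 : S * 1 ≤ S * (H.length) := Nat.mul_le_mul_left _ h0
      have h5 : 2 * (2 * S) * H.length = 4 * (S * H.length) := by ring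
      have h6 : 20 * S * (S / 4) = 20 * (S * (S / 4)) := by ring
      unfold XB
      rw [h5, h6]
      omega
  have main : ∃ xs : List (FreeGroup β), xs.length ≤ g ∧ mk cs.flatten = (xs.map (· ^ 2)).prod ∧
      ∀ x ∈ xs, x.norm ≤ XB S := by
    rcases List.eq_nil_or_concat Y with hY | ⟨Y1, y, hY⟩
    · obtain ⟨xs, h1, h2, h3⟩ := key 1 (by simp) (fun _ _ => trivial)
      refine ⟨xs, ?_, ?_, h3⟩
      · have := b2 hY; omega
      · rw [e1, hY, ← h2]; simp
    · rw [List.concat_eq_append] at hY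
      subst hY
      have hy := e2 y (by simp)
      have hy' := norm_mk_le (L₁ := y)
      obtain ⟨xs, h1, h2, h3⟩ := key (mk y) (by omega) (fun _ _ => trivial)
      refine ⟨Y1.map mk ++ xs, ?_, ?_, ?_⟩
      · simp at b1 ⊢; omega
      · rw [e1, List.map_append, List.map_append, List.prod_append, List.prod_append, ← h2,
          List.map_map]
        simp only [List.map_cons, List.map_nil, List.prod_cons, List.prod_nil, mul_one, mul_assoc]
        rfl
      · intro x hx
        rcases List.mem_append.1 hx with hx | hx
        · obtain ⟨z, hz, rfl⟩ := List.mem_map.1 hx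
          have h4 := e2 z (by simp [hz])
          have h5 := norm_mk_le (L₁ := z)
          unfold XB
          omega
        · exact h3 x hx
  obtain ⟨xs, h1, h2, h3⟩ := main
  refine ⟨xs ++ List.replicate (g - xs.length) 1, by simp; omega, by simp [h2], ?_⟩
  intro x hx
  rcases List.mem_append.1 hx with hx | hx
  · exact h3 x hx
  · rw [List.eq_of_mem_replicate hx]; simp

end conv

section solv
variable {G : Type*} [Group G]

theorem Solv.perm {g : ℕ} {L L' : List G} (h : Solv g L) (hp : L.Perm L') : Solv g L' := by
  obtain ⟨xs, h1, T, h2, h3⟩ := h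
  exact ⟨xs, h1, T, h2.trans hp, h3⟩

theorem extract {A B : Type*} {T : List (A × B)} {c : A} {L : List A}
    (h : (T.map Prod.fst).Perm (c :: L)) :
    ∃ T1 t T2, T = T1 ++ (c, t) :: T2 ∧ ((T1 ++ T2).map Prod.fst).Perm L := by
  have hc : c ∈ T.map Prod.fst := h.mem_iff.2 (by simp)
  obtain ⟨⟨c', t⟩, ht, rfl⟩ := List.mem_map.1 hc
  obtain ⟨T1, T2, rfl⟩ := List.append_of_mem ht
  refine ⟨T1, t, T2, rfl, ?_⟩
  have : ((T1 ++ (c', t) :: T2).map Prod.fst).Perm (c' :: ((T1 ++ T2).map Prod.fst)) := by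
    simp only [List.map_append, List.map_cons]
    exact List.perm_middle
  exact (this.symm.trans h).cons_inv

theorem Solv.replace {g : ℕ} {L : List G} {c c' : G} (h : Solv g (c :: L))
    (hr : ∀ t, ∃ t', val (c, t) = val (c', t')) : Solv g (c' :: L) := by
  obtain ⟨xs, h1, T, h2, h3⟩ := h
  obtain ⟨T1, t, T2, rfl, h4⟩ := extract h2
  obtain ⟨t', ht'⟩ := hr t
  refine ⟨xs, h1, T1 ++ (c', t') :: T2, ?_, ?_⟩
  · have : ((T1 ++ (c', t') :: T2).map Prod.fst).Perm (c' :: ((T1 ++ T2).map Prod.fst)) := by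
      simp only [List.map_append, List.map_cons]
      exact List.perm_middle
    exact this.trans (h4.cons _)
  · rw [← h3]; simp [ht']

theorem Solv.conj {g : ℕ} {L : List G} {c : G} (h : Solv g (c :: L)) (a : G) :
    Solv g (a⁻¹ * c * a :: L) := by
  apply h.replace
  rintro ⟨s, z⟩
  refine ⟨(s, a⁻¹ * z), ?_⟩
  cases s <;> simp [val] <;> group

theorem Solv.inv {g : ℕ} {L : List G} {c : G} (h : Solv g (c :: L)) :
    Solv g (c⁻¹ :: L) := by
  apply h.replace
  rintro ⟨s, z⟩
  refine ⟨(!s, z), ?_⟩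
  cases s <;> simp [val]

theorem Solv.one {g : ℕ} {L : List G} (h : Solv g (1 :: L)) : Solv g L := by
  obtain ⟨xs, h1, T, h2, h3⟩ := h
  obtain ⟨T1, ⟨s, z⟩, T2, rfl, h4⟩ := extract h2
  refine ⟨xs, h1, T1 ++ T2, h4, ?_⟩
  rw [← h3]
  cases s <;> simp [val]

theorem Solv.hom {G' : Type*} [Group G'] (φ : G →* G') {g : ℕ} {L : List G} (h : Solv g L) :
    Solv g (L.map φ) := by
  obtain ⟨xs, h1, T, h2, h3⟩ := h
  refine ⟨xs.map φ, by simpa using h1, T.map fun t => (φ t.1, t.2.1, φ t.2.2), ?_, ?_⟩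
  · have := h2.map φ
    simpa [List.map_map, Function.comp_def] using this
  · have := congrArg φ h3
    rw [_root_.map_mul, map_list_prod, map_list_prod, _root_.map_one] at this
    rw [← this, List.map_map, List.map_map, List.map_map, List.map_map]
    congr 2
    · apply List.map_congr_left; intro x _; simp
    · apply List.map_congr_left
      rintro ⟨c, s, z⟩ _
      cases s <;> simp [val]

end solv
end QE

namespace QE
open FreeGroup
section cluster
variable {β : Type*} [DecidableEq β]

/-- Every rotation of `c` is a product of signed conjugates of the words of `S`
by short elements. -/
def Exp (c : List (β × Bool)) (S : List (List (β × Bool))) : Prop :=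
  ∀ c', c.IsRotated c' → ∃ T : List (FreeGroup β × Bool × FreeGroup β),
    (T.map Prod.fst).Perm (S.map mk) ∧ mk c' = (T.map val).prod ∧
    ∀ t ∈ T, t.2.2.norm + 1 ≤ S.flatten.length

theorem rot_split {A : Type*} {c c' : List A} (h : c.IsRotated c') :
    ∃ a b, c = a ++ b ∧ c' = b ++ a := by
  obtain ⟨n, hn, rfl⟩ := List.isRotated_iff_mod.1 h
  exact ⟨c.take n, c.drop n, (List.take_append_drop n c).symm,
    List.rotate_eq_drop_append_take hn⟩

theorem exp_rot {c c' : List (β × Bool)} {S} (h : Exp c S) (hr : c.IsRotated c') : Exp c' S :=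
  fun d hd => h d (hr.trans hd)

theorem exp_self {c : List (β × Bool)} (hc : c ≠ []) : Exp c [c] := by
  intro c' h
  obtain ⟨a, b, rfl, rfl⟩ := rot_split h
  by_cases hb : b = []
  · subst hb
    refine ⟨[(mk (a ++ []), true, 1)], by simp, by simp [val], ?_⟩
    have := List.length_pos_iff.2 hc
    simp at this ⊢
    omega
  · refine ⟨[(mk (a ++ b), true, mk a)], by simp, ?_, ?_⟩
    · simp only [List.map_cons, List.map_nil, List.prod_cons, List.prod_nil, val, mk_app, cond_true]
      group
    · have := List.length_pos_iff.2 hb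
      have h2 := norm_mk_le (L₁ := a)
      simp
      omega

theorem conj_prod {G : Type*} [Group G] (T : List (G × Bool × G)) (a : G) :
    ((T.map fun t => (t.1, t.2.1, t.2.2 * a)).map val).prod = a⁻¹ * (T.map val).prod * a := by
  induction T with
  | nil => simp
  | cons t T ih =>
    rw [List.map_cons, List.map_cons, List.prod_cons, ih, List.map_cons, List.prod_cons]
    obtain ⟨c, s, z⟩ := t
    cases s <;> simp only [val, cond_true, cond_false] <;> group

theorem inv_prod {G : Type*} [Group G] (T : List (G × Bool × G)) :
    ((T.reverse.map fun t => (t.1, !t.2.1, t.2.2)).map val).prod = ((T.map val).prod)⁻¹ := by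
  induction T with
  | nil => simp
  | cons t T ih =>
    rw [List.reverse_cons, List.map_append, List.map_append, List.prod_append, ih]
    simp only [List.map_cons, List.map_nil, List.prod_cons, List.prod_nil, mul_one, mul_inv_rev]
    congr 1
    obtain ⟨c, s, z⟩ := t
    cases s <;> simp [val, mul_assoc]

theorem exp_inv {c : List (β × Bool)} {S} (h : Exp c S) : Exp (invRev c) S := by
  intro c' hc'
  have h1 : c.IsRotated (invRev c') := by
    have h2 : (invRev (invRev c)).IsRotated (invRev c') := by
      unfold invRev at hc' ⊢
      exact (hc'.map _).reverse
    rwa [invRev_invRev] at h2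
  obtain ⟨T, t1, t2, t3⟩ := h _ h1
  refine ⟨T.reverse.map fun t => (t.1, !t.2.1, t.2.2), ?_, ?_, ?_⟩
  · rw [List.map_map]
    have : (T.reverse.map Prod.fst).Perm (S.map mk) :=
      ((List.reverse_perm T).map _).trans t1
    exact this
  · rw [inv_prod, ← t2, mk_invRev, inv_inv]
  · intro t ht
    obtain ⟨t', ht', rfl⟩ := List.mem_map.1 ht
    exact t3 t' (List.mem_reverse.1 ht')

theorem exp_half {x : β × Bool} {u1 u2 v : List (β × Bool)} {S1 S2}
    (h1 : Exp (x :: (u1 ++ u2)) S1) (h2 : Exp (nx x :: v) S2)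
    (l1 : u1.length ≤ S1.flatten.length) :
    ∃ T : List (FreeGroup β × Bool × FreeGroup β),
    (T.map Prod.fst).Perm ((S1 ++ S2).map mk) ∧ mk (u2 ++ v ++ u1) = (T.map val).prod ∧
    ∀ t ∈ T, t.2.2.norm + 1 ≤ (S1 ++ S2).flatten.length := by
  have hr : (x :: (u1 ++ u2)).IsRotated (u2 ++ ([x] ++ u1)) := by
    have := @List.isRotated_append _ ([x] ++ u1) u2
    simpa using this
  obtain ⟨T1, a1, a2, a3⟩ := h1 _ hr
  obtain ⟨T2, b1, b2, b3⟩ := h2 _ (List.IsRotated.refl _)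
  refine ⟨T1 ++ T2.map fun t => (t.1, t.2.1, t.2.2 * mk u1), ?_, ?_, ?_⟩
  · rw [List.map_append, List.map_append, List.map_map]
    exact a1.append b1
  · rw [List.map_append, List.prod_append, conj_prod, ← a2, ← b2, mk_cons (nx x)]
    simp only [mk_app, mk_nx]
    group
  · intro t ht
    rw [List.flatten_append, List.length_append]
    rcases List.mem_append.1 ht with ht | ht
    · have := a3 t ht; omega
    · obtain ⟨t', ht', rfl⟩ := List.mem_map.1 ht
      have h3 := b3 t' ht'
      have h4 := norm_mul_le t'.2.2 (mk u1)
      have h5 := norm_mk_le (L₁ := u1)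
      simp only
      omega

theorem exp_join {x : β × Bool} {u v : List (β × Bool)} {S1 S2}
    (h1 : Exp (x :: u) S1) (h2 : Exp (nx x :: v) S2)
    (l1 : u.length ≤ S1.flatten.length) (l2 : v.length ≤ S2.flatten.length) :
    Exp (u ++ v) (S1 ++ S2) := by
  intro c' hc'
  obtain ⟨a, b, e1, rfl⟩ := rot_split hc'
  rcases List.append_eq_append_iff.1 e1 with ⟨w, rfl, rfl⟩ | ⟨w, rfl, rfl⟩
  · have h1' : Exp (nx (nx x) :: u) S1 := by rwa [nx_nx]
    obtain ⟨T, t1, t2, t3⟩ := exp_half h2 h1' (by rw [List.length_append] at l2; omega)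
    refine ⟨T, t1.trans (List.perm_append_comm.map _), by rw [← t2]; simp, fun t ht => ?_⟩
    have := t3 t ht
    simp only [List.flatten_append, List.length_append] at this ⊢
    omega
  · obtain ⟨T, t1, t2, t3⟩ := exp_half h1 h2 (by rw [List.length_append] at l1; omega)
    exact ⟨T, t1, by rw [← t2], t3⟩

theorem rot_head {x : β × Bool} {p : List (β × Bool)} (hx : x ∈ p) :
    ∃ u, p.IsRotated (x :: u) ∧ ∃ a, mk (x :: u) = a⁻¹ * mk p * a := by
  obtain ⟨a, c, rfl⟩ := List.append_of_mem hx
  refine ⟨c ++ a, ?_, mk a, ?_⟩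
  · have := @List.isRotated_append _ a (x :: c)
    simpa using this
  · rw [mk_cons x (c ++ a), mk_app, mk_app, mk_cons x c]
    group

theorem rot_head' {x y : β × Bool} {p : List (β × Bool)} {S} (hy : y ∈ p) (hxy : y.1 = x.1)
    (hE : Exp p S) :
    ∃ v, Exp (nx x :: v) S ∧ v.length + 1 = p.length ∧ (∀ b, cnt b (nx x :: v) = cnt b p) ∧
    ∃ a, mk (nx x :: v) = a⁻¹ * mk p * a ∨ mk (nx x :: v) = a⁻¹ * (mk p)⁻¹ * a := by
  rcases eq_of_fst hxy with rfl | rfl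
  · have hm : nx y ∈ invRev p := by
      simp only [invRev, List.mem_reverse, List.mem_map]
      exact ⟨y, hy, rfl⟩
    obtain ⟨v, hv, a, ha⟩ := rot_head hm
    refine ⟨v, exp_rot (exp_inv hE) hv, ?_, ?_, a, Or.inr ?_⟩
    · have := hv.perm.length_eq
      simp at this
      omega
    · intro b; rw [← cnt_perm hv.perm, cnt_invRev]
    · rw [ha, mk_invRev]
  · obtain ⟨v, hv, a, ha⟩ := rot_head hy
    refine ⟨v, exp_rot hE hv, ?_, ?_, a, Or.inl ha⟩
    · have := hv.perm.length_eq
      simp at this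
      omega
    · intro b; rw [← cnt_perm hv.perm]

theorem lift_fix {f : β → FreeGroup β} {w : List (β × Bool)}
    (h : ∀ x ∈ w, f x.1 = of x.1) : lift f (mk w) = mk w := by
  rw [lift_congr (f' := of) h]
  have : lift (of : β → FreeGroup β) = MonoidHom.id _ := by ext; simp
  rw [this]; rfl

theorem cnt_zero {b : β} {w : List (β × Bool)} (h : cnt b w = 0) : ∀ x ∈ w, x.1 ≠ b := by
  rintro x hx rfl
  have := cnt_pos' hx
  omega

theorem solv_join {g : ℕ} {x : β × Bool} {u v : List (β × Bool)} {L : List (List (β × Bool))}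
    (h : Solv g (mk (x :: u) :: mk (nx x :: v) :: L.map mk)) (hu : cnt x.1 u = 0)
    (hv : cnt x.1 v = 0) (hL : ∀ w ∈ L, cnt x.1 w = 0) :
    Solv g (mk (u ++ v) :: L.map mk) := by
  have hfix : ∀ w, cnt x.1 w = 0 →
      lift (Function.update of x.1 (cond x.2 (mk v) (mk v)⁻¹)) (mk w) = mk w := by
    intro w hw
    apply lift_fix
    intro y hy
    rw [Function.update_of_ne (cnt_zero hw y hy)]
  have h1 := h.hom (lift (Function.update of x.1 (cond x.2 (mk v) (mk v)⁻¹)))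
  rw [List.map_cons, List.map_cons, mk_cons x, mk_cons (nx x), mk_nx, _root_.map_mul,
    _root_.map_mul, _root_.map_inv, lift_letter, hfix u hu, hfix v hv, List.map_map] at h1
  have h2 : L.map ((lift (Function.update of x.1 (cond x.2 (mk v) (mk v)⁻¹))) ∘ mk) = L.map mk := by
    apply List.map_congr_left
    intro w hw
    exact hfix w (hL w hw)
  rw [h2, inv_mul_cancel] at h1
  have h3 := ((h1.perm (List.Perm.swap _ _ _)).one).conj (mk v)
  have h4 : (mk v)⁻¹ * (mk v * mk u) * mk v = mk (u ++ v) := by rw [mk_app]; group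
  rwa [h4] at h3

/-- Total length. -/
def tot (P : List (List (β × Bool) × List (List (β × Bool)))) : ℕ :=
  ((P.map Prod.snd).flatten).flatten.length

theorem tot_cons (p) (P : List (List (β × Bool) × List (List (β × Bool)))) :
    tot (p :: P) = p.2.flatten.length + tot P := by
  simp [tot]

theorem all_exp : ∀ (P : List (List (β × Bool) × List (List (β × Bool)))),
    (∀ p ∈ P, Exp p.1 p.2) → ∃ T : List (FreeGroup β × Bool × FreeGroup β),
    (T.map Prod.fst).Perm ((P.map Prod.snd).flatten.map mk) ∧
    mk (P.map Prod.fst).flatten = (T.map val).prod ∧ ∀ t ∈ T, t.2.2.norm + 1 ≤ tot P := by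
  intro P
  induction P with
  | nil => intro _; exact ⟨[], by simp, by simp [mk_nil], by simp⟩
  | cons p P ih =>
    intro h
    obtain ⟨T, t1, t2, t3⟩ := ih fun q hq => h q (by simp [hq])
    obtain ⟨T', s1, s2, s3⟩ := h p (by simp) _ (List.IsRotated.refl _)
    refine ⟨T' ++ T, ?_, ?_, ?_⟩
    · simp only [List.map_append, List.map_cons, List.flatten_cons]
      exact s1.append t1
    · simp only [List.map_append, List.map_cons, List.flatten_cons, mk_app, List.prod_append, s2, t2]
    · intro t ht
      rw [tot_cons]
      rcases List.mem_append.1 ht with ht | ht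
      · have := s3 t ht; omega
      · have := t3 t ht; omega

/-- The conclusion of the cluster induction. -/
def Concl (g : ℕ) (P : List (List (β × Bool) × List (List (β × Bool)))) : Prop :=
  ∃ xs : List (FreeGroup β), xs.length = g ∧ (∀ x ∈ xs, x.norm ≤ XB (tot P)) ∧
  ∃ T : List (FreeGroup β × Bool × FreeGroup β),
    (T.map Prod.fst).Perm ((P.map Prod.snd).flatten.map mk) ∧
    (xs.map (· ^ 2)).prod * (T.map val).prod = 1 ∧ ∀ t ∈ T, t.2.2.norm + 1 ≤ tot P

theorem sq_inv {G : Type*} [Group G] (xs : List G) :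
    ((xs.reverse.map (·⁻¹)).map (· ^ 2)).prod = ((xs.map (· ^ 2)).prod)⁻¹ := by
  induction xs with
  | nil => simp
  | cons x xs ih => simpa using ih

theorem cluster_base {g : ℕ} (hg : 1 ≤ g) (P : List (List (β × Bool) × List (List (β × Bool))))
    (hE : ∀ p ∈ P, Exp p.1 p.2 ∧ p.1.length ≤ p.2.flatten.length)
    (hc : ∀ b, cnt b (P.map Prod.fst).flatten = 0 ∨ cnt b (P.map Prod.fst).flatten = 2)
    (hev : ∀ p ∈ P, ∀ b, Even (cnt b p.1))
    (hS : Solv g ((P.map Prod.fst).map mk)) : Concl g P := by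
  have hlen : ∀ P : List (List (β × Bool) × List (List (β × Bool))),
      (∀ p ∈ P, p.1.length ≤ p.2.flatten.length) → (P.map Prod.fst).flatten.length ≤ tot P := by
    intro P
    induction P with
    | nil => simp
    | cons p P ih =>
      intro h
      have h1 := ih fun q hq => h q (by simp [hq])
      have h2 := h p (by simp)
      rw [tot_cons, List.map_cons, List.flatten_cons, List.length_append]
      omega
  obtain ⟨xs, x1, x2, x3⟩ := base_squares hg (P.map Prod.fst) (by
    intro c hc b
    obtain ⟨p, hp, rfl⟩ := List.mem_map.1 hc
    exact hev p hp b) hc hS (tot P) (hlen P fun p hp => (hE p hp).2)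
  obtain ⟨T, t1, t2, t3⟩ := all_exp P fun p hp => (hE p hp).1
  refine ⟨xs.reverse.map (·⁻¹), by simpa using x1, ?_, T, t1, ?_, t3⟩
  · intro x hx
    obtain ⟨y, hy, rfl⟩ := List.mem_map.1 hx
    rw [norm_inv_eq]
    exact x3 y (List.mem_reverse.1 hy)
  · rw [sq_inv, ← x2, t2, inv_mul_cancel]

theorem flat_perm {A : Type*} {l l' : List (List A)} (h : l.Perm l') :
    l.flatten.Perm l'.flatten := h.flatten

theorem Concl.perm {g : ℕ} {P P' : List (List (β × Bool) × List (List (β × Bool)))}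
    (h : Concl g P) (hp : P.Perm P') : Concl g P' := by
  have h1 := flat_perm (hp.map Prod.snd)
  have ht : tot P = tot P' := (flat_perm h1).length_eq
  obtain ⟨xs, x1, x2, T, t1, t2, t3⟩ := h
  rw [ht] at x2 t3
  exact ⟨xs, x1, x2, T, t1.trans (h1.map _), t2, t3⟩

theorem cluster {g : ℕ} (hg : 1 ≤ g) :
    ∀ n (P : List (List (β × Bool) × List (List (β × Bool)))), P.length ≤ n →
    (∀ p ∈ P, Exp p.1 p.2 ∧ p.1.length ≤ p.2.flatten.length) →
    (∀ b, cnt b (P.map Prod.fst).flatten = 0 ∨ cnt b (P.map Prod.fst).flatten = 2) →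
    Solv g ((P.map Prod.fst).map mk) → Concl g P := by
  intro n
  induction n with
  | zero =>
    intro P hP hE hc hS
    have : P = [] := List.eq_nil_of_length_eq_zero (by omega)
    subst this
    exact cluster_base hg [] hE hc (by simp) hS
  | succ n ih =>
    intro P hP hE hc hS
    by_cases hev : ∀ p ∈ P, ∀ b, Even (cnt b p.1)
    · exact cluster_base hg P hE hc hev hS
    push Not at hev
    obtain ⟨p1, hp1, b, hb⟩ := hev
    have hb : Odd (cnt b p1.1) := by simpa using hb
    obtain ⟨P1, hP1⟩ : ∃ P1, P.Perm (p1 :: P1) := by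
      obtain ⟨s, t, rfl⟩ := List.append_of_mem hp1
      exact ⟨s ++ t, List.perm_middle⟩
    have hcP1 : ∀ b', cnt b' (P.map Prod.fst).flatten =
        cnt b' p1.1 + cnt b' (P1.map Prod.fst).flatten := by
      intro b'
      rw [cnt_perm (flat_perm (hP1.map _)), List.map_cons, List.flatten_cons, cnt_app]
    have hb1 : cnt b p1.1 = 1 ∧ cnt b (P1.map Prod.fst).flatten = 1 := by
      have h1 := hcP1 b
      obtain ⟨k, hk⟩ := hb
      rcases hc b with h | h <;> omega
    obtain ⟨y, hy, hyb⟩ := cnt_pos (b := b) (v := (P1.map Prod.fst).flatten) (by omega)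
    obtain ⟨w, hw, hyw⟩ := List.mem_flatten.1 hy
    obtain ⟨p2, hp2, rfl⟩ := List.mem_map.1 hw
    obtain ⟨P2, hP2⟩ : ∃ P2, P1.Perm (p2 :: P2) := by
      obtain ⟨s, t, rfl⟩ := List.append_of_mem hp2
      exact ⟨s ++ t, List.perm_middle⟩
    have hcP2 : ∀ b', cnt b' (P1.map Prod.fst).flatten =
        cnt b' p2.1 + cnt b' (P2.map Prod.fst).flatten := by
      intro b'
      rw [cnt_perm (flat_perm (hP2.map _)), List.map_cons, List.flatten_cons, cnt_app]
    have hyc := cnt_pos' hyw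
    rw [hyb] at hyc
    have hb2 := hcP2 b
    obtain ⟨x, hx, hxb⟩ := cnt_pos (b := b) (v := p1.1) (by omega)
    obtain ⟨u, hu, a, ha⟩ := rot_head hx
    have hPP : P.Perm (p1 :: p2 :: P2) := hP1.trans (hP2.cons _)
    have hE1 := hE p1 hp1
    have hE2 := hE p2 (hPP.mem_iff.2 (by simp))
    obtain ⟨v, hv1, hv2, hv3, a', ha'⟩ := rot_head' hyw (hyb.trans hxb.symm) hE2.1
    have hul : u.length + 1 = p1.1.length := by
      have := hu.perm.length_eq
      simp at this; omega
    have hu3 : ∀ b', cnt b' (x :: u) = cnt b' p1.1 := fun b' => (cnt_perm hu.perm b').symm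
    have hS1 : Solv g (mk p1.1 :: mk p2.1 :: (P2.map Prod.fst).map mk) :=
      hS.perm ((hPP.map _).map _)
    have hS2 : Solv g (mk (x :: u) :: mk p2.1 :: (P2.map Prod.fst).map mk) := by
      rw [ha]; exact hS1.conj a
    have hS3 : Solv g (mk (x :: u) :: mk (nx x :: v) :: (P2.map Prod.fst).map mk) := by
      refine Solv.perm ?_ (List.Perm.swap _ _ _)
      have h := hS2.perm (List.Perm.swap _ _ _)
      rcases ha' with ha' | ha'
      · rw [ha']; exact h.conj a'
      · rw [ha']; exact h.inv.conj a'
    have hucons : ∀ b', cnt b' u + (if x.1 = b' then 1 else 0) = cnt b' p1.1 := by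
      intro b'; rw [← hu3, cnt_cons]
    have hvcons : ∀ b', cnt b' v + (if x.1 = b' then 1 else 0) = cnt b' p2.1 := by
      intro b'; rw [← hv3, cnt_cons, nx_fst]
    have hub := hucons b
    have hvb := hvcons b
    rw [if_pos hxb] at hub hvb
    have hS4 := solv_join hS3 (by rw [hxb]; omega) (by rw [hxb]; omega) (by
      intro w hw
      by_contra hne
      obtain ⟨y, hy, hy'⟩ := cnt_pos (Nat.pos_of_ne_zero hne)
      have := cnt_pos' (List.mem_flatten.2 ⟨w, hw, hy⟩)
      rw [hy', hxb] at this
      omega)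
    have hres := ih ((u ++ v, p1.2 ++ p2.2) :: P2) (by
        have := hPP.length_eq
        simp at this ⊢; omega) (by
        intro p hp
        rcases List.mem_cons.1 hp with rfl | hp
        · refine ⟨exp_join (exp_rot hE1.1 hu) hv1 (by omega) (by omega), ?_⟩
          simp only [List.flatten_append, List.length_append]
          omega
        · exact hE p (hPP.mem_iff.2 (by simp [hp]))) (by
        intro b'
        rw [List.map_cons, List.flatten_cons, cnt_app, cnt_app]
        have h1 := hcP1 b'
        have h2 := hcP2 b'
        have h3 := hucons b'
        have h4 := hvcons b'
        have h5 := hc b'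
        split_ifs at h3 h4 <;> omega) (by
        rw [List.map_cons, List.map_cons]; exact hS4)
    refine Concl.perm ?_ hPP.symm
    have htot : tot ((u ++ v, p1.2 ++ p2.2) :: P2) = tot (p1 :: p2 :: P2) := by
      simp only [tot_cons, List.flatten_append, List.length_append]; omega
    obtain ⟨xs, x1, x2, T, t1, t2, t3⟩ := hres
    rw [htot] at x2 t3
    refine ⟨xs, x1, x2, T, ?_, t2, t3⟩
    simpa using t1

/-- Main result of this part. -/
theorem cluster_main {g : ℕ} (hg : 1 ≤ g) (K : List (List (β × Bool))) (hne : ∀ c ∈ K, c ≠ [])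
    (hc : ∀ b, cnt b K.flatten = 0 ∨ cnt b K.flatten = 2) (hS : Solv g (K.map mk)) :
    ∃ xs : List (FreeGroup β), xs.length = g ∧ (∀ x ∈ xs, x.norm ≤ XB K.flatten.length) ∧
    ∃ T : List (FreeGroup β × Bool × FreeGroup β), (T.map Prod.fst).Perm (K.map mk) ∧
    (xs.map (· ^ 2)).prod * (T.map val).prod = 1 ∧
    ∀ t ∈ T, t.2.2.norm + 1 ≤ K.flatten.length := by
  have e1 : (K.map fun c => (c, [c])).map Prod.fst = K := by
    rw [List.map_map]; exact List.map_id _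
  have e2 : ((K.map fun c => (c, [c])).map Prod.snd).flatten = K := by
    rw [List.map_map]
    clear hne hc hS e1
    induction K with
    | nil => rfl
    | cons c K ih => simpa using ih
  have h := cluster hg _ (K.map fun c => (c, [c])) le_rfl (by
    intro p hp
    obtain ⟨c, hc, rfl⟩ := List.mem_map.1 hp
    exact ⟨exp_self (hne c hc), by simp⟩) (by rwa [e1]) (by rwa [e1])
  unfold Concl tot at h
  rwa [e2] at h

end cluster
end QE

namespace QE
open FreeGroup
section subst
variable {β γ δ : Type*}

/-- Letter substitution, extended to signed letters. -/
def sub (σ : β → γ × Bool) (x : β × Bool) : γ × Bool := cond x.2 (σ x.1) (nx (σ x.1))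

theorem sub_nx (σ : β → γ × Bool) (x : β × Bool) : sub σ (nx x) = nx (sub σ x) := by
  rcases x with ⟨b, s⟩; cases s <;> simp [sub, nx]

theorem sub_sub (σ : β → γ × Bool) (τ : γ → δ × Bool) (x : β × Bool) :
    sub (fun b => sub τ (σ b)) x = sub τ (sub σ x) := by
  rcases x with ⟨b, s⟩
  cases s
  · change nx (sub τ (σ b)) = sub τ (nx (σ b)); rw [sub_nx]
  · rfl

theorem mk_sub (σ : β → γ × Bool) (w : List (β × Bool)) :
    mk (w.map (sub σ)) = lift (fun b => mk [σ b]) (mk w) := by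
  induction w with
  | nil => simp [mk_nil]
  | cons x w ih =>
    rw [List.map_cons, mk_cons, ih, mk_cons x, _root_.map_mul]
    congr 1
    rw [lift_mk]
    rcases x with ⟨b, s⟩
    cases s <;> simp only [sub, cond_false, cond_true, mk_nx, List.map_cons, List.map_nil,
      List.prod_cons, List.prod_nil, mul_one]

theorem cancel_pair {L : List (β × Bool)} (h : mk L = 1) (hne : L ≠ []) :
    ∃ L1 x L2, L = L1 ++ x :: nx x :: L2 := by
  have h1 : mk L = mk [] := h
  rw [Red.exact] at h1
  obtain ⟨c, hc1, hc2⟩ := h1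
  rw [Red.nil_iff] at hc2
  subst hc2
  rcases Relation.ReflTransGen.cases_head hc1 with h2 | ⟨d, hd, -⟩
  · exact absurd h2 hne
  · cases hd with
    | @not L1 L2 x b => exact ⟨L1, (x, b), L2, rfl⟩

variable [DecidableEq β]

/-- The substitution identifying the letter of `q` with the inverse of `p`. -/
def ident (p q : β × Bool) (b : β) : β × Bool :=
  if b = q.1 then cond q.2 (nx p) p else (b, true)

theorem sub_ident_q (p q : β × Bool) : sub (ident p q) q = nx p := by
  rcases q with ⟨b, s⟩; cases s <;> simp [sub, ident]

theorem sub_ident_ne (p q x : β × Bool) (h : x.1 ≠ q.1) : sub (ident p q) x = x := by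
  rcases x with ⟨b, s⟩; cases s <;> simp_all [sub, ident, nx]

theorem cnt_ident (p q : β × Bool) (h : p.1 ≠ q.1) (b : β) (w : List (β × Bool)) :
    cnt b (w.map (sub (ident p q))) = if b = q.1 then 0 else
      if b = p.1 then cnt p.1 w + cnt q.1 w else cnt b w := by
  induction w with
  | nil => simp
  | cons x w ih =>
    rw [List.map_cons, cnt_cons, ih, cnt_cons, cnt_cons, cnt_cons]
    have : (sub (ident p q) x).1 = if x.1 = q.1 then p.1 else x.1 := by
      rcases x with ⟨a, s⟩
      rcases q with ⟨c, t⟩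
      by_cases hx : a = c
      · cases s <;> cases t <;> simp [sub, ident, hx]
      · rw [sub_ident_ne _ _ _ hx, if_neg hx]
    rw [this]
    by_cases e1 : b = q.1
    · rw [if_pos e1, if_pos e1]
      by_cases e2 : x.1 = q.1
      · rw [if_pos e2, if_neg (by rw [e1]; exact h)]
      · rw [if_neg e2, if_neg (by rw [e1]; exact e2)]
    · rw [if_neg e1, if_neg e1]
      by_cases e2 : x.1 = q.1
      · rw [if_pos e2]
        by_cases e3 : b = p.1
        · rw [if_pos e3, if_pos e3, if_pos e3.symm, if_pos e2, if_neg (by rw [e2]; exact h.symm)]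
          omega
        · rw [if_neg e3, if_neg e3, if_neg (fun e => e3 e.symm),
            if_neg (fun e => e1 (e.symm.trans e2))]
      · rw [if_neg e2, if_neg e2]
        by_cases e3 : b = p.1
        · rw [if_pos e3, if_pos e3, ← e3]; omega
        · rw [if_neg e3, if_neg e3]

theorem mk_cancel {ε : Type*} (ρ : β → ε × Bool) {R1 R2 : List (β × Bool)} {p q : β × Bool}
    (h : sub ρ q = nx (sub ρ p)) :
    mk ((R1 ++ p :: q :: R2).map (sub ρ)) = mk ((R1 ++ R2).map (sub ρ)) := by
  rw [List.map_append, List.map_cons, List.map_cons, mk_app, mk_cons, mk_cons (sub ρ q), h,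
    mk_nx, mul_inv_cancel_left, List.map_append, mk_app]

theorem lift_lemma (π : β → γ × Bool) : ∀ n (R K : List (β × Bool)), R.length ≤ n →
    (∀ b, cnt b (R ++ K) = 0 ∨ cnt b (R ++ K) = 2) → mk (R.map (sub π)) = 1 →
    ∃ σ : β → β × Bool, (∀ b, sub π (σ b) = π b) ∧ mk (R.map (sub σ)) = 1 ∧
      ∀ b, cnt b (K.map (sub σ)) = 0 ∨ cnt b (K.map (sub σ)) = 2 := by
  intro n
  induction n with
  | zero =>
    intro R K hR hc _
    have : R = [] := List.eq_nil_of_length_eq_zero (by omega)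
    subst this
    refine ⟨fun b => (b, true), fun b => rfl, rfl, ?_⟩
    have : sub (fun b : β => (b, true)) = id := by
      funext x; rcases x with ⟨b, s⟩; cases s <;> simp [sub, nx]
    rw [this, List.map_id]
    exact hc
  | succ n ih =>
    intro R K hR hc hmk
    by_cases hne : R = []
    · subst hne; exact ih [] K (by simp) hc hmk
    obtain ⟨L1, y, L2, hL⟩ := cancel_pair hmk (by simpa using hne)
    obtain ⟨R1, R', rfl, hR1, hR'⟩ := List.map_eq_append_iff.1 hL
    obtain ⟨p, R'', rfl, hp, hR''⟩ := List.map_eq_cons_iff.1 hR'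
    obtain ⟨q, R2, rfl, hq, hR2⟩ := List.map_eq_cons_iff.1 hR''
    clear hL hR' hR'' hne
    have hpq : sub π q = nx (sub π p) := by rw [hp, hq]
    clear hR1 hR2 hp hq
    rw [mk_cancel π hpq] at hmk
    have hcc : ∀ b, cnt b (R1 ++ p :: q :: R2 ++ K) = cnt b (R1 ++ R2) + cnt b K +
        (if p.1 = b then 1 else 0) + (if q.1 = b then 1 else 0) := by
      intro b; simp only [cnt_app, cnt_cons]; omega
    by_cases h : q.1 = p.1
    · have hq : q = nx p := by
        rcases eq_of_fst h with rfl | h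
        · exact absurd hpq.symm (nx_ne _)
        · exact h
      obtain ⟨σ, s1, s2, s3⟩ := ih (R1 ++ R2) K (by simp at hR ⊢; omega) (by
        intro b
        have h1 := hc b
        rw [hcc b] at h1
        rw [cnt_app b (R1 ++ R2)]
        rw [h] at h1
        by_cases e : p.1 = b
        · rw [if_pos e] at h1; omega
        · rw [if_neg e] at h1; omega) hmk
      refine ⟨σ, s1, ?_, s3⟩
      rw [mk_cancel σ (by rw [hq, sub_nx]), s2]
    · have h' : p.1 ≠ q.1 := fun e => h e.symm
      have hτ : ∀ b, sub π (ident p q b) = π b := by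
        intro b
        unfold ident
        split_ifs with hb
        · subst hb
          rcases q with ⟨c, t⟩
          cases t
          · simp only [cond_false]
            rw [← nx_nx (sub π p), ← hpq]; simp [sub]
          · simp only [cond_true]
            rw [sub_nx, ← hpq]; simp [sub]
        · rfl
      have hτ' : ∀ x, sub π (sub (ident p q) x) = sub π x := by
        intro x; rw [← sub_sub]; congr 1; funext b; exact hτ b
      obtain ⟨σ, s1, s2, s3⟩ := ih ((R1 ++ R2).map (sub (ident p q))) (K.map (sub (ident p q)))
        (by simp at hR ⊢; omega) (by
        intro b
        rw [← List.map_append, cnt_ident p q h']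
        have h1 := hc b
        have h2 := hc p.1
        have h3 := hc q.1
        rw [hcc] at h1 h2 h3
        simp only [cnt_app b (R1 ++ R2), cnt_app p.1 (R1 ++ R2), cnt_app q.1 (R1 ++ R2)]
        rw [if_pos rfl, if_neg h] at h2
        rw [if_pos rfl, if_neg h'] at h3
        split_ifs with e1 e2
        · omega
        · omega
        · rw [if_neg (fun e => e2 e.symm), if_neg (fun e => e1 e.symm)] at h1; omega) (by
        rw [List.map_map]
        have : (R1 ++ R2).map (sub π ∘ sub (ident p q)) = (R1 ++ R2).map (sub π) :=
          List.map_congr_left fun x _ => hτ' x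
        rw [this, hmk])
      have hσ : ∀ w : List (β × Bool), w.map (sub fun b => sub σ (ident p q b)) =
          (w.map (sub (ident p q))).map (sub σ) := by
        intro w; rw [List.map_map]; exact List.map_congr_left fun x _ => sub_sub _ _ _
      refine ⟨fun b => sub σ (ident p q b), ?_, ?_, ?_⟩
      · intro b
        rw [← sub_sub]
        rw [← hτ b]
        congr 1; funext c; exact s1 c
      · rw [mk_cancel _ (by rw [sub_sub, sub_sub, sub_ident_q, sub_ident_ne _ _ _ h', sub_nx]), hσ, s2]
      · rw [hσ]; exact s3

theorem norm_lift_le [DecidableEq γ] (π : β → γ × Bool) (x : FreeGroup β) :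
    (lift (fun b => mk [π b]) x).norm ≤ x.norm := by
  have h : x = mk x.toWord := mk_toWord.symm
  have h2 : lift (fun b => mk [π b]) x = mk (x.toWord.map (sub π)) := by
    rw [mk_sub, mk_toWord]
  rw [h2]
  refine norm_mk_le.trans ?_
  simp [FreeGroup.norm]

theorem cnt_le_one {w : List (β × Bool)} (h : (w.map Prod.fst).Nodup) (b : β) : cnt b w ≤ 1 :=
  List.nodup_iff_count_le_one.1 h b

theorem cnt_flatten (b : β) (L : List (List (β × Bool))) :
    cnt b L.flatten = (L.map (cnt b)).sum := by
  induction L with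
  | nil => rfl
  | cons a L ih => simp [cnt_app, ih]

theorem mk_flatten (L : List (List (β × Bool))) : mk L.flatten = (L.map mk).prod := by
  induction L with
  | nil => rfl
  | cons a L ih => simp only [List.flatten_cons, mk_app, ih, List.map_cons, List.prod_cons]

end subst

section lab
variable {I α : Type*}

/-- The word with distinct letters over a given word. -/
def lw (i : I) (w : List (α × Bool)) : List ((I × ℕ × (α × Bool)) × Bool) :=
  w.zipIdx.map fun p => ((i, p.2, p.1), true)

theorem lw_sub (i : I) (w : List (α × Bool)) :
    (lw i w).map (sub fun b : I × ℕ × (α × Bool) => b.2.2) = w := by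
  unfold lw
  rw [List.map_map]
  exact List.zipIdx_map_fst 0 w

theorem lw_length (i : I) (w : List (α × Bool)) : (lw i w).length = w.length := by simp [lw]

variable [DecidableEq I] [DecidableEq α]

theorem lw_cnt_ne (i : I) (w : List (α × Bool)) (b : I × ℕ × (α × Bool)) (h : b.1 ≠ i) :
    cnt b (lw i w) = 0 := by
  by_contra hne
  obtain ⟨x, hx, rfl⟩ := cnt_pos (Nat.pos_of_ne_zero hne)
  obtain ⟨p, -, rfl⟩ := List.mem_map.1 hx
  exact h rfl

theorem lw_cnt_le (i : I) (w : List (α × Bool)) (b : I × ℕ × (α × Bool)) :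
    cnt b (lw i w) ≤ 1 := by
  refine cnt_le_one ?_ b
  unfold lw
  rw [List.map_map]
  have h : (w.zipIdx.map Prod.snd).Nodup := by
    rw [List.zipIdx_map_snd]; exact List.nodup_range'
  have h2 : w.zipIdx.Nodup := List.Nodup.of_map _ h
  apply h2.map
  rintro ⟨a, k⟩ ⟨a', k'⟩ h
  simp at h
  ext <;> simp [h]

theorem lw_total [Fintype I] (word : I → List (α × Bool)) (b : I × ℕ × (α × Bool)) :
    ∑ i, cnt b (lw i (word i)) ≤ 1 := by
  rw [Finset.sum_eq_single b.1]
  · exact lw_cnt_le _ _ _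
  · intro i _ hi; exact lw_cnt_ne _ _ _ (fun e => hi e.symm)
  · simp

end lab
end QE

namespace QE
open FreeGroup
section reduction
variable {α : Type*} [DecidableEq α]

theorem cnt_le_length (b : α) (w : List (α × Bool)) : cnt b w ≤ w.length := by
  unfold cnt
  exact List.count_le_length.trans (by rw [List.length_map])

theorem reduction (g k : ℕ) (hg : 1 ≤ g)
    (Cj : Fin k → FreeGroup α) (C : FreeGroup α)
    (hCj : ∀ j, Cj j ≠ 1) (hC : C ≠ 1)
    (s : ℕ) (hs : s = (∑ j, (Cj j).norm) + C.norm)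
    (x : Fin g → FreeGroup α) (z : Fin k → FreeGroup α)
    (hsol : (List.ofFn fun i => x i ^ 2).prod *
        (List.ofFn fun j => (z j)⁻¹ * Cj j * z j).prod * C = 1) :
    2 ≤ s ∧ ∃ xs : List (FreeGroup α), xs.length = g ∧ (∀ x ∈ xs, x.norm ≤ XB s) ∧
    ∃ T : List (FreeGroup α × Bool × FreeGroup α), (T.map Prod.fst).Perm (List.ofFn Cj ++ [C]) ∧
    (xs.map (· ^ 2)).prod * (T.map val).prod = 1 ∧ ∀ t ∈ T, t.2.2.norm + 1 ≤ s := by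
  classical
  let I := (Fin g ⊕ Fin k) ⊕ (Fin k ⊕ Unit)
  let word : I → List (α × Bool) := Sum.elim (Sum.elim (fun i => (x i).toWord)
    (fun j => (z j).toWord)) (Sum.elim (fun j => (Cj j).toWord) (fun _ => C.toWord))
  let π : I × ℕ × (α × Bool) → α × Bool := fun b => b.2.2
  let w : I → List ((I × ℕ × (α × Bool)) × Bool) := fun i => lw i (word i)
  let X : Fin g → List ((I × ℕ × (α × Bool)) × Bool) := fun i => w (Sum.inl (Sum.inl i))
  let Z : Fin k → List ((I × ℕ × (α × Bool)) × Bool) := fun j => w (Sum.inl (Sum.inr j))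
  let D : Fin k → List ((I × ℕ × (α × Bool)) × Bool) := fun j => w (Sum.inr (Sum.inl j))
  let E : List ((I × ℕ × (α × Bool)) × Bool) := w (Sum.inr (Sum.inr ()))
  let R := (List.ofFn fun i => X i ++ X i).flatten ++
    (List.ofFn fun j => invRev (Z j) ++ D j ++ Z j).flatten ++ E
  let K := List.ofFn D ++ [E]
  have hw : ∀ i, mk ((w i).map (sub π)) = mk (word i) := fun i => by rw [lw_sub]
  have hmkR : mk R = (List.ofFn fun i => mk (X i) ^ 2).prod *
      (List.ofFn fun j => (mk (Z j))⁻¹ * mk (D j) * mk (Z j)).prod * mk E := by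
    simp only [R, mk_app, mk_flatten, List.map_ofFn, Function.comp_def, mk_invRev, pow_two]
  have hhom : ∀ {H : Type _} [Group H] (φ : FreeGroup (I × ℕ × (α × Bool)) →* H), φ (mk R) =
      (List.ofFn fun i => φ (mk (X i)) ^ 2).prod *
      (List.ofFn fun j => (φ (mk (Z j)))⁻¹ * φ (mk (D j)) * φ (mk (Z j))).prod * φ (mk E) := by
    intro H _ φ
    rw [hmkR]
    simp only [_root_.map_mul, map_list_prod, List.map_ofFn, Function.comp_def, _root_.map_inv,
      _root_.map_pow]
  have hX : ∀ i, lift (fun b => mk [π b]) (mk (X i)) = x i := fun i => by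
    rw [← mk_sub, hw]; exact mk_toWord
  have hZ : ∀ i, lift (fun b => mk [π b]) (mk (Z i)) = z i := fun i => by
    rw [← mk_sub, hw]; exact mk_toWord
  have hD : ∀ i, lift (fun b => mk [π b]) (mk (D i)) = Cj i := fun i => by
    rw [← mk_sub, hw]; exact mk_toWord
  have hE : lift (fun b => mk [π b]) (mk E) = C := by
    rw [← mk_sub, hw]; exact mk_toWord
  have hR1 : mk (R.map (sub π)) = 1 := by
    rw [mk_sub, hhom]
    simp only [hX, hZ, hD, hE]
    exact hsol
  have hcnt : ∀ b, cnt b (R ++ K.flatten) = 0 ∨ cnt b (R ++ K.flatten) = 2 := by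
    intro b
    have h1 := lw_total word b
    rw [Fintype.sum_sum_type, Fintype.sum_sum_type, Fintype.sum_sum_type] at h1
    have h2 : cnt b (R ++ K.flatten) = 2 * (((∑ i, cnt b (X i)) + ∑ i, cnt b (Z i)) +
        ((∑ i, cnt b (D i)) + ∑ _i : Unit, cnt b E)) := by
      simp only [R, K, cnt_app, cnt_flatten, List.map_ofFn, List.sum_ofFn, Function.comp_def,
        cnt_invRev, Finset.sum_add_distrib, List.flatten_append, List.flatten_cons,
        List.flatten_nil, cnt_nil, Finset.univ_unique, Finset.sum_const, Finset.card_singleton]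
      simp only [smul_eq_mul]
      omega
    have h3 : (((∑ i, cnt b (X i)) + ∑ i, cnt b (Z i)) +
        ((∑ i, cnt b (D i)) + ∑ _i : Unit, cnt b E)) ≤ 1 := h1
    omega
  obtain ⟨σ, s1, s2, s3⟩ := lift_lemma π _ R K.flatten le_rfl hcnt hR1
  have hππ : ∀ v : List ((I × ℕ × (α × Bool)) × Bool),
      lift (fun b => mk [π b]) (mk (v.map (sub σ))) = lift (fun b => mk [π b]) (mk v) := by
    intro v
    rw [← mk_sub, List.map_map, ← mk_sub]
    congr 1
    apply List.map_congr_left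
    intro y _
    change sub π (sub σ y) = sub π y
    rw [← sub_sub]
    congr 1; funext b; exact s1 b
  have hflat : (K.map (List.map (sub σ))).flatten = K.flatten.map (sub σ) :=
    List.map_flatten.symm
  have hlen : (K.map (List.map (sub σ))).flatten.length = s := by
    rw [hflat, List.length_map, hs]
    simp only [K, List.length_flatten, List.map_append, List.map_ofFn, List.sum_append,
      List.sum_ofFn, Function.comp_def, List.map_cons, List.map_nil, List.sum_cons, List.sum_nil,
      add_zero]
    congr 1
    · apply Finset.sum_congr rfl
      intro j _
      exact lw_length _ _
    · exact lw_length _ _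
  have hEne : E ≠ [] := by
    intro h
    have h1 : E.length = C.norm := lw_length _ _
    rw [h] at h1
    exact hC (norm_eq_zero.1 h1.symm)
  have hne : ∀ c ∈ K.map (List.map (sub σ)), c ≠ [] := by
    intro c hc
    obtain ⟨d, hd, rfl⟩ := List.mem_map.1 hc
    rcases List.mem_append.1 hd with hd | hd
    · obtain ⟨j, rfl⟩ := (List.mem_ofFn' _ _).1 hd
      intro h
      have h1 : (D j).length = (Cj j).norm := lw_length _ _
      have h2 := congrArg List.length h
      rw [List.length_map, h1] at h2
      exact hCj j (norm_eq_zero.1 h2)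
    · have : d = E := by simpa using hd
      rw [this]; simpa using hEne
  have hSolv : Solv g ((K.map (List.map (sub σ))).map mk) := by
    rw [mk_sub, hhom] at s2
    refine ⟨List.ofFn fun i => lift (fun b => mk [σ b]) (mk (X i)), by simp,
      (List.ofFn fun j => (lift (fun b => mk [σ b]) (mk (D j)), true,
        lift (fun b => mk [σ b]) (mk (Z j)))) ++ [(lift (fun b => mk [σ b]) (mk E), true, 1)],
      ?_, ?_⟩
    · apply List.Perm.of_eq
      simp only [K, List.map_append, List.map_ofFn, Function.comp_def, List.map_cons, List.map_nil,
        mk_sub]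
    · refine Eq.trans ?_ s2
      simp only [List.map_append, List.map_ofFn, Function.comp_def, List.map_cons, List.map_nil,
        val, cond_true, List.prod_append, List.prod_cons, List.prod_nil, inv_one, one_mul, mul_one,
        mul_assoc]
  refine ⟨?_, ?_⟩
  · obtain ⟨y, hy⟩ : ∃ y, y ∈ (K.map (List.map (sub σ))).flatten := by
      obtain ⟨e, he⟩ := List.exists_mem_of_ne_nil _ hEne
      rw [hflat]
      exact ⟨sub σ e, List.mem_map_of_mem (List.mem_flatten.2 ⟨E, by simp [K], he⟩)⟩
    have h1 := cnt_pos' hy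
    have h2 := s3 y.1
    rw [← hflat] at h2
    have h3 : cnt y.1 (K.map (List.map (sub σ))).flatten ≤
        (K.map (List.map (sub σ))).flatten.length := cnt_le_length _ _
    omega
  · obtain ⟨xs, x1, x2, T, t1, t2, t3⟩ := cluster_main hg _ hne (by rw [hflat]; exact s3) hSolv
    rw [hlen] at x2 t3
    let Ψ := lift (fun b => mk [π b])
    have hΨ : ∀ y, (Ψ y).norm ≤ y.norm := norm_lift_le π
    refine ⟨xs.map Ψ, by simpa using x1, ?_, T.map fun t => (Ψ t.1, t.2.1, Ψ t.2.2), ?_, ?_, ?_⟩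
    · intro y hy
      obtain ⟨y', hy', rfl⟩ := List.mem_map.1 hy
      exact (hΨ _).trans (x2 _ hy')
    · have h1 := t1.map Ψ
      have h2 : ((K.map (List.map (sub σ))).map mk).map Ψ = List.ofFn Cj ++ [C] := by
        simp only [K, List.map_append, List.map_ofFn, Function.comp_def, List.map_cons,
          List.map_nil, Ψ, hππ, hD, hE]
      rw [h2] at h1
      simpa [List.map_map, Function.comp_def] using h1
    · have h1 := congrArg Ψ t2
      rw [_root_.map_mul, map_list_prod, map_list_prod, _root_.map_one] at h1
      rw [← h1, List.map_map, List.map_map, List.map_map, List.map_map]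
      congr 2
      · apply List.map_congr_left; intro y _; simp
      · apply List.map_congr_left
        rintro ⟨c, b, y⟩ _
        cases b <;> simp [val]
    · intro t ht
      obtain ⟨t', ht', rfl⟩ := List.mem_map.1 ht
      have h1 := t3 t' ht'
      have h2 := hΨ t'.2.2
      simp only
      omega

end reduction
end QE

namespace QE
open FreeGroup
section final
variable {α : Type*} [DecidableEq α]

/-- Total norm of the values. -/
def vn (T : List (FreeGroup α × Bool × FreeGroup α)) : ℕ := (T.map fun t => (val t).norm).sum

theorem vn_cons (t) (T : List (FreeGroup α × Bool × FreeGroup α)) :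
    vn (t :: T) = (val t).norm + vn T := by simp [vn]

theorem vn_append (T T' : List (FreeGroup α × Bool × FreeGroup α)) :
    vn (T ++ T') = vn T + vn T' := by simp [vn]

theorem norm_prod_le (T : List (FreeGroup α × Bool × FreeGroup α)) :
    ((T.map val).prod).norm ≤ vn T := by
  induction T with
  | nil => simp
  | cons t T ih =>
    rw [List.map_cons, List.prod_cons, vn_cons]
    have := norm_mul_le (val t) (T.map val).prod
    omega

theorem val_norm (t : FreeGroup α × Bool × FreeGroup α) :
    (val t).norm ≤ 2 * t.2.2.norm + t.1.norm := by
  obtain ⟨c, s, z⟩ := t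
  have h1 := norm_mul_le (z⁻¹ * (cond s c c⁻¹)) z
  have h2 := norm_mul_le z⁻¹ (cond s c c⁻¹)
  have h3 : (cond s c c⁻¹).norm = c.norm := by cases s <;> simp
  have h4 : z⁻¹.norm = z.norm := norm_inv_eq
  simp only [val]
  omega

theorem vn_le (Z : ℕ) (T : List (FreeGroup α × Bool × FreeGroup α)) (h : ∀ t ∈ T, t.2.2.norm ≤ Z) :
    vn T ≤ 2 * (T.length * Z) + ((T.map Prod.fst).map FreeGroup.norm).sum := by
  induction T with
  | nil => simp [vn]
  | cons t T ih =>
    have h1 := ih fun t ht => h t (by simp [ht])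
    have h2 := h t (by simp)
    have h3 := val_norm t
    rw [vn_cons]
    simp only [List.map_cons, List.sum_cons, List.length_cons, add_mul, one_mul]
    omega

theorem reorder (Z : ℕ) : ∀ (L : List (FreeGroup α)) (T : List (FreeGroup α × Bool × FreeGroup α)),
    (T.map Prod.fst).Perm L → (∀ t ∈ T, t.2.2.norm ≤ Z) →
    ∃ T' : List (FreeGroup α × Bool × FreeGroup α), T'.map Prod.fst = L ∧
    (T'.map val).prod = (T.map val).prod ∧ ∀ t ∈ T', t.2.2.norm ≤ Z + vn T := by
  intro L
  induction L with
  | nil =>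
    intro T hT _
    have : T = [] := by simpa using hT.eq_nil
    subst this
    exact ⟨[], by simp, by simp, by simp⟩
  | cons c L ih =>
    intro T hT hZ
    obtain ⟨A, ⟨s, z⟩, B, rfl, hAB⟩ := extract hT
    obtain ⟨T', h1, h2, h3⟩ := ih (A ++ B) hAB (by
      intro t ht
      apply hZ
      rcases List.mem_append.1 ht with ht | ht <;> simp [ht])
    refine ⟨(c, s, z * ((A.map val).prod)⁻¹) :: T', by simp [h1], ?_, ?_⟩
    · rw [List.map_cons, List.prod_cons, h2]
      simp only [List.map_append, List.prod_append, List.map_cons, List.prod_cons, val]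
      group
    · intro t ht
      rw [vn_append, vn_cons]
      rcases List.mem_cons.1 ht with rfl | ht
      · have h4 := norm_mul_le z ((A.map val).prod)⁻¹
        rw [norm_inv_eq] at h4
        have h5 := norm_prod_le A
        have h6 := hZ (c, s, z) (by simp)
        simp only at h6 ⊢
        omega
      · have := h3 t ht
        rw [vn_append] at this
        omega

theorem signs (Z : ℕ) : ∀ (T : List (FreeGroup α × Bool × FreeGroup α)) (x : FreeGroup α),
    (∀ t ∈ T, t.2.2.norm ≤ Z) →
    ∃ (T' : List (FreeGroup α × FreeGroup α)) (y : FreeGroup α),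
    T'.map Prod.fst = T.map Prod.fst ∧
    x ^ 2 * (T.map val).prod = (T'.map fun t => t.2⁻¹ * t.1 * t.2).prod * y ^ 2 ∧
    y.norm ≤ x.norm + vn T ∧ ∀ t ∈ T', t.2.norm ≤ Z + 2 * (x.norm + vn T) := by
  intro T
  induction T with
  | nil => intro x _; exact ⟨[], x, by simp, by simp, by simp, by simp⟩
  | cons t T ih =>
    intro x hZ
    have hz := hZ t (by simp)
    obtain ⟨c, s, z⟩ := t
    simp only at hz
    cases s
    · obtain ⟨T', y, h1, h2, h3, h4⟩ := ih (x * val (c, false, z)) fun t ht => hZ t (by simp [ht])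
      have h5 := norm_mul_le x (val (c, false, z))
      refine ⟨(c, z * (x * val (c, false, z))⁻¹) :: T', y, by simp [h1], ?_, ?_, ?_⟩
      · rw [List.map_cons, List.prod_cons, List.map_cons, List.prod_cons, mul_assoc _ _ (y ^ 2),
          ← h2]
        simp only [val, cond_false, pow_two]
        group
      · rw [vn_cons]; omega
      · intro t ht
        rw [vn_cons]
        rcases List.mem_cons.1 ht with rfl | ht
        · have h6 := norm_mul_le z (x * val (c, false, z))⁻¹
          rw [norm_inv_eq] at h6
          simp only
          omega
        · have := h4 t ht
          omega
    · obtain ⟨T', y, h1, h2, h3, h4⟩ := ih x fun t ht => hZ t (by simp [ht])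
      refine ⟨(c, z * (x * x)⁻¹) :: T', y, by simp [h1], ?_, ?_, ?_⟩
      · rw [List.map_cons, List.prod_cons, List.map_cons, List.prod_cons, mul_assoc _ _ (y ^ 2),
          ← h2]
        simp [val, pow_two, mul_assoc]
      · rw [vn_cons]; omega
      · intro t ht
        rw [vn_cons]
        rcases List.mem_cons.1 ht with rfl | ht
        · have h6 := norm_mul_le z (x * x)⁻¹
          rw [norm_inv_eq] at h6
          have h7 := norm_mul_le x x
          simp only
          omega
        · have := h4 t ht
          omega

theorem conj_sq {G : Type*} [Group G] (xs : List G) (w : G) :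
    ((xs.map fun x => w * x * w⁻¹).map (· ^ 2)).prod = w * (xs.map (· ^ 2)).prod * w⁻¹ := by
  induction xs with
  | nil => simp
  | cons x xs ih =>
    simp only [List.map_cons, List.prod_cons] at ih ⊢
    rw [ih]
    simp only [pow_two]
    group

theorem conj_ts {G : Type*} [Group G] (ts : List (G × G)) (w : G) :
    (ts.map fun t => (t.2 * w⁻¹)⁻¹ * t.1 * (t.2 * w⁻¹)).prod =
      w * (ts.map fun t => t.2⁻¹ * t.1 * t.2).prod * w⁻¹ := by
  induction ts with
  | nil => simp
  | cons t ts ih =>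
    simp only [List.map_cons, List.prod_cons]
    rw [ih]
    group

theorem exists_ofFn {A : Type*} {n : ℕ} {l : List A} (h : l.length = n) :
    ∃ f : Fin n → A, l = List.ofFn f := by
  subst h
  exact ⟨l.get, (List.ofFn_get l).symm⟩

theorem arith {s X D1 D2 Z2 : ℕ} (hs : 2 ≤ s) (hX : X = XB s) (hD1 : D1 ≤ 2 * (s * (s - 1)) + s)
    (hZ2 : Z2 = (s - 1) + D1) (hD2 : D2 ≤ 2 * (s * Z2) + s) :
    (X + D2) + 2 * (Z2 + 2 * (X + D2)) ≤ 12 * s ^ 4 := by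
  obtain ⟨r, rfl⟩ : ∃ r, s = r + 2 := ⟨s - 2, by omega⟩
  have e1 : r + 2 - 1 = r + 1 := by omega
  rw [e1] at hD1 hZ2
  have h1 : Z2 + 1 ≤ 2 * (r + 2) ^ 2 := by nlinarith
  have h2 : D2 + (r + 2) ≤ 4 * (r + 2) ^ 3 := by
    have : (r + 2) * (Z2 + 1) ≤ (r + 2) * (2 * (r + 2) ^ 2) := Nat.mul_le_mul_left _ h1
    nlinarith
  have h3 : 5 * X + 5 * (4 * (r + 2) ^ 3) + 4 * (r + 2) ^ 2 ≤ 12 * (r + 2) ^ 4 + 5 * (r + 2) + 2 := by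
    subst hX
    unfold XB
    rcases Nat.lt_or_ge r 2 with h | h
    · interval_cases r <;> norm_num
    · obtain ⟨q, rfl⟩ : ∃ q, r = q + 2 := ⟨r - 2, by omega⟩
      have h4 : 4 * ((q + 2 + 2) / 4) ≤ q + 4 := by omega
      have h5 : (q + 4) * (4 * ((q + 2 + 2) / 4)) ≤ (q + 4) * (q + 4) := Nat.mul_le_mul_left _ h4
      have h6 : 20 * (q + 2 + 2) * ((q + 2 + 2) / 4) ≤ 5 * ((q + 4) * (q + 4)) := by nlinarith
      have h7 : 5 * (2 * (q + 2 + 2) + 5 * ((q + 4) * (q + 4))) + 5 * (4 * (q + 2 + 2) ^ 3) +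
          4 * (q + 2 + 2) ^ 2 ≤ 12 * (q + 2 + 2) ^ 4 + 5 * (q + 2 + 2) + 2 := by
        ring_nf
        nlinarith [sq_nonneg (q : ℤ), Nat.zero_le (q ^ 2), Nat.zero_le (q ^ 3), Nat.zero_le (q ^ 4)]
      omega
  omega

theorem bounded_solution (g k : ℕ) (hg : 1 ≤ g)
    (Cj : Fin k → FreeGroup α) (C : FreeGroup α)
    (hCj : ∀ j, Cj j ≠ 1) (hC : C ≠ 1)
    (s : ℕ) (hs : s = (∑ j, (Cj j).norm) + C.norm)
    (x : Fin g → FreeGroup α) (z : Fin k → FreeGroup α)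
    (hsol : (List.ofFn fun i => x i ^ 2).prod *
        (List.ofFn fun j => (z j)⁻¹ * Cj j * z j).prod * C = 1) :
    ∃ x' : Fin g → FreeGroup α, ∃ z' : Fin k → FreeGroup α,
      (List.ofFn fun i => x' i ^ 2).prod *
        (List.ofFn fun j => (z' j)⁻¹ * Cj j * z' j).prod * C = 1 ∧
      (∀ i, (x' i).norm ≤ 12 * s ^ 4) ∧
      (∀ j, (z' j).norm ≤ 12 * s ^ 4) := by
  obtain ⟨hs2, xs, x1, x2, T, t1, t2, t3⟩ := reduction g k hg Cj C hCj hC s hs x z hsol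
  have hpos : ∀ c : FreeGroup α, c ≠ 1 → 1 ≤ c.norm := by
    intro c hc
    by_contra h
    exact hc (norm_eq_zero.1 (by omega))
  have hks : k + 1 ≤ s := by
    have h1 : ∑ _j : Fin k, 1 ≤ ∑ j, (Cj j).norm := Finset.sum_le_sum fun j _ => hpos _ (hCj j)
    have h2 := hpos C hC
    simp at h1
    omega
  have hsum : ((List.ofFn Cj ++ [C]).map FreeGroup.norm).sum = s := by
    simp [List.sum_ofFn, Function.comp_def, hs]
  have hz1 : ∀ t ∈ T, t.2.2.norm ≤ s - 1 := fun t ht => by have := t3 t ht; omega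
  obtain ⟨T2, a1, a2, a3⟩ := reorder (s - 1) _ T t1 hz1
  have hlenT : T.length = k + 1 := by simpa using t1.length_eq
  have hlenT2 : T2.length = k + 1 := by simpa using congrArg List.length a1
  have hD1 : vn T ≤ 2 * (s * (s - 1)) + s := by
    have h1 := vn_le (s - 1) T hz1
    rw [(t1.map _).sum_eq, hsum, hlenT] at h1
    have h2 : (k + 1) * (s - 1) ≤ s * (s - 1) := Nat.mul_le_mul_right _ hks
    omega
  have hD2 : vn T2 ≤ 2 * (s * (s - 1 + vn T)) + s := by
    have h1 := vn_le _ T2 a3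
    rw [a1, hsum, hlenT2] at h1
    have h2 : (k + 1) * (s - 1 + vn T) ≤ s * (s - 1 + vn T) := Nat.mul_le_mul_right _ hks
    omega
  have hfin := arith hs2 rfl hD1 rfl hD2
  rcases List.eq_nil_or_concat xs with hnil | ⟨xs0, x0, hxs⟩
  · subst hnil; simp at x1; omega
  rw [List.concat_eq_append] at hxs
  subst hxs
  have hx0 := x2 x0 (by simp)
  obtain ⟨T3, y, b1, b2, b3, b4⟩ := signs _ T2 x0 a3
  rw [a1] at b1
  obtain ⟨T4, T5, rfl, c1, c2⟩ := List.map_eq_append_iff.1 b1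
  obtain ⟨⟨C', w⟩, T6, rfl, c3, c4⟩ := List.map_eq_cons_iff.1 c2
  have : T6 = [] := by simpa using c4
  subst this
  simp only at c3
  subst c3
  obtain ⟨f, hf⟩ := exists_ofFn (l := (y :: xs0).map fun x => w * x * w⁻¹) (n := g)
    (by simp at x1 ⊢; omega)
  obtain ⟨t, ht⟩ := exists_ofFn (l := T4) (n := k) (by simpa using congrArg List.length c1)
  have htC : ∀ j, (t j).1 = Cj j := by
    rw [ht, List.map_ofFn] at c1
    exact fun j => congrFun (List.ofFn_injective c1) j
  have hw := b4 (C', w) (by simp)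
  simp only at hw
  refine ⟨f, fun j => (t j).2 * w⁻¹, ?_, ?_, ?_⟩
  · have e1 : (List.ofFn fun i => f i ^ 2) = ((y :: xs0).map fun x => w * x * w⁻¹).map (· ^ 2) := by
      rw [hf, List.map_ofFn]; rfl
    have e2 : (List.ofFn fun j => ((t j).2 * w⁻¹)⁻¹ * Cj j * ((t j).2 * w⁻¹)) =
        T4.map fun t => (t.2 * w⁻¹)⁻¹ * t.1 * (t.2 * w⁻¹) := by
      rw [ht, List.map_ofFn]
      congr 1
      funext j
      simp [htC]
    rw [e1, e2, conj_sq, conj_ts]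
    simp only [List.map_append, List.prod_append, List.map_cons, List.map_nil, List.prod_cons,
      List.prod_nil, mul_one] at t2 b2 ⊢
    rw [← a2, mul_assoc, b2] at t2
    have t2' := congrArg (fun u => w * y ^ 2 * u * (y ^ 2)⁻¹ * w⁻¹) t2
    have e3 : w * y ^ 2 * 1 * (y ^ 2)⁻¹ * w⁻¹ = 1 := by group
    rw [e3] at t2'
    rw [← t2']
    group
  · intro i
    have hi : f i ∈ (y :: xs0).map fun x => w * x * w⁻¹ := by rw [hf]; simp
    obtain ⟨x', hx', hfx⟩ := List.mem_map.1 hi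
    rw [← hfx]
    have h1 := norm_mul_le (w * x') w⁻¹
    have h2 := norm_mul_le w x'
    rw [norm_inv_eq] at h1
    have h3 : x'.norm ≤ XB s + vn T2 := by
      rcases List.mem_cons.1 hx' with rfl | hx'
      · omega
      · have := x2 x' (by simp [hx']); omega
    omega
  · intro j
    have hj : t j ∈ T4 := by rw [ht]; simp
    have h1 := b4 (t j) (by simp [hj])
    have h2 := norm_mul_le (t j).2 w⁻¹
    rw [norm_inv_eq] at h2
    change ((t j).2 * w⁻¹).norm ≤ _
    omega

end final
end QE

/-- **Minimal solutions of standard non-orientable quadratic equations.** If the equation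
`(∏ᵢ xᵢ²) (∏ⱼ zⱼ⁻¹ Cⱼ zⱼ) C = 1` with nontrivial cyclically reduced coefficients has a
solution in a free group, then it has a solution all of whose values have length at most
`12 s⁴`, where `s` is the total length of the coefficients. -/
theorem stmt_4 {α : Type*} [DecidableEq α] (g m : ℕ) (hg : 1 ≤ g) (hm : 1 ≤ m)
    (Cj : Fin (m - 1) → FreeGroup α) (C : FreeGroup α)
    (hCj : ∀ j, Cj j ≠ 1 ∧ CyclicallyReduced (Cj j))
    (hC : C ≠ 1) (hCred : CyclicallyReduced C)
    (s : ℕ) (hs : s = (∑ j, (Cj j).norm) + C.norm)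
    (x : Fin g → FreeGroup α) (z : Fin (m - 1) → FreeGroup α)
    (hsol : (List.ofFn fun i => x i ^ 2).prod *
        (List.ofFn fun j => (z j)⁻¹ * Cj j * z j).prod * C = 1) :
    ∃ x' : Fin g → FreeGroup α, ∃ z' : Fin (m - 1) → FreeGroup α,
      (List.ofFn fun i => x' i ^ 2).prod *
        (List.ofFn fun j => (z' j)⁻¹ * Cj j * z' j).prod * C = 1 ∧
      (∀ i, (x' i).norm ≤ 12 * s ^ 4) ∧
      (∀ j, (z' j).norm ≤ 12 * s ^ 4) := by
  exact QE.bounded_solution g (m - 1) hg Cj C (fun j => (hCj j).1) hC s hs x z hsol
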